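/- arXiv:1711.03853 — 6 statements merged into one kernel-verified Lean document; each statement's English description precedes it below -/
import Mathlib

section
/- Comparison principle: Let H∈C(ℝⁿ) and let u₁, u₂ ∈ BUC_loc(Π̄) be respectively a viscosity subsolution and a viscosity supersolution of u_t+H(∇_x u)=0 with initial data u₁₀, u₂₀ ∈ BUC(ℝⁿ). If u₁₀(x) ≤ u₂₀(x) for all x∈ℝⁿ, then u₁(t,x) ≤ u₂(t,x) for all (t,x)∈Π. -/
open Set Filter Topology RealInnerProductSpace MeasureTheory

noncomputable section

variable {E : Type*} [NormedAddCommGroup E] [InnerProductSpace ℝ E]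

/-- The open half-space `Π = (0,∞) × ℝⁿ`. -/
def PiDom (E : Type*) [NormedAddCommGroup E] [InnerProductSpace ℝ E] : Set (ℝ × E) :=
  Set.Ioi (0:ℝ) ×ˢ (Set.univ : Set E)

/-- Bounded uniformly continuous functions on `ℝⁿ`. -/
def IsBUC (u₀ : E → ℝ) : Prop :=
  UniformContinuous u₀ ∧ ∃ M : ℝ, ∀ x, |u₀ x| ≤ M

/-- `BUC_loc(Π̄)` : continuous on `Π̄ = [0,∞)×ℝⁿ`, bounded and uniformly continuous on
each layer `[0,T)×ℝⁿ`, `T>0`. -/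
def IsBUCloc (u : ℝ × E → ℝ) : Prop :=
  ContinuousOn u (Set.Ici (0:ℝ) ×ˢ (Set.univ : Set E)) ∧
  ∀ T : ℝ, 0 < T →
    (∃ M : ℝ, ∀ p ∈ Set.Ico (0:ℝ) T ×ˢ (Set.univ : Set E), |u p| ≤ M) ∧
    UniformContinuousOn u (Set.Ico (0:ℝ) T ×ˢ (Set.univ : Set E))

/-- The superdifferential `D⁺u(t₀,x₀)`: pairs `(s,v) = ∇φ(t₀,x₀)` over all `C¹` functions `φ`
such that `(t₀,x₀)` is a point of local maximum of `u - φ` in `Π`. -/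
def superdiff (u : ℝ × E → ℝ) (p : ℝ × E) : Set (ℝ × E) :=
  {sv | ∃ φ : ℝ × E → ℝ, ContDiff ℝ 1 φ ∧
    IsLocalMaxOn (fun q => u q - φ q) (PiDom E) p ∧
    fderiv ℝ φ p (1, 0) = sv.1 ∧ ∀ w : E, fderiv ℝ φ p (0, w) = ⟪sv.2, w⟫}

/-- The subdifferential `D⁻u(t₀,x₀)`. -/
def subdiff (u : ℝ × E → ℝ) (p : ℝ × E) : Set (ℝ × E) :=
  {sv | ∃ φ : ℝ × E → ℝ, ContDiff ℝ 1 φ ∧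
    IsLocalMinOn (fun q => u q - φ q) (PiDom E) p ∧
    fderiv ℝ φ p (1, 0) = sv.1 ∧ ∀ w : E, fderiv ℝ φ p (0, w) = ⟪sv.2, w⟫}

/-- Viscosity subsolution of `u_t + H(∇ₓu) = 0`, `u(0,·) = u₀`. -/
def IsViscSubsol (H : E → ℝ) (u₀ : E → ℝ) (u : ℝ × E → ℝ) : Prop :=
  IsBUCloc u ∧ (∀ x, u (0, x) ≤ u₀ x) ∧
  ∀ p ∈ PiDom E, ∀ sv ∈ superdiff u p, sv.1 + H sv.2 ≤ 0

/-- Viscosity supersolution of `u_t + H(∇ₓu) = 0`, `u(0,·) = u₀`. -/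
def IsViscSupersol (H : E → ℝ) (u₀ : E → ℝ) (u : ℝ × E → ℝ) : Prop :=
  IsBUCloc u ∧ (∀ x, u₀ x ≤ u (0, x)) ∧
  ∀ p ∈ PiDom E, ∀ sv ∈ subdiff u p, 0 ≤ sv.1 + H sv.2

/-- Viscosity solution of `u_t + H(∇ₓu) = 0`, `u(0,·) = u₀`. -/
def IsViscSol (H : E → ℝ) (u₀ : E → ℝ) (u : ℝ × E → ℝ) : Prop :=
  IsViscSubsol H u₀ u ∧ IsViscSupersol H u₀ u

open Real in
/-- Quadratic penalty centred at `q`, plus a coercive term in space and an exponential barrier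
in time. -/
def penalty (A B a k t₀ : ℝ) (q p : ℝ × E) : ℝ :=
  A * ((p.1 - q.1) ^ 2 + ‖p.2 - q.2‖ ^ 2) + B * ‖p.2‖ ^ 2 + a * exp (k * (p.1 - t₀))

lemma contDiff_penalty (A B a k t₀ : ℝ) (q : ℝ × E) :
    ContDiff ℝ 1 (penalty A B a k t₀ q) := by
  unfold penalty
  have h₁ : ContDiff ℝ 1 (fun p : ℝ × E => ‖p.2 - q.2‖ ^ 2) :=
    (contDiff_snd.sub contDiff_const).norm_sq ℝ
  have h₂ : ContDiff ℝ 1 (fun p : ℝ × E => ‖p.2‖ ^ 2) := contDiff_snd.norm_sq ℝ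
  fun_prop

lemma fderiv_penalty_apply (A B a k t₀ : ℝ) (q p w : ℝ × E) :
    fderiv ℝ (penalty A B a k t₀ q) p w =
      (2 * A * (p.1 - q.1) + a * k * Real.exp (k * (p.1 - t₀))) * w.1
        + ⟪(2 * A) • (p.2 - q.2) + (2 * B) • p.2, w.2⟫ := by
  have hfst : HasFDerivAt (fun p : ℝ × E => p.1) (ContinuousLinearMap.fst ℝ ℝ E) p :=
    hasFDerivAt_fst
  have hsnd : HasFDerivAt (fun p : ℝ × E => p.2) (ContinuousLinearMap.snd ℝ ℝ E) p :=
    hasFDerivAt_snd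
  have h := (((((hfst.sub_const q.1).pow 2).add (hsnd.sub_const q.2).norm_sq).const_mul A).add
    (hsnd.norm_sq.const_mul B)).add ((((hfst.sub_const t₀).const_mul k).exp).const_mul a)
  have h' : HasFDerivAt (penalty A B a k t₀ q) _ p := h
  rw [h'.fderiv]
  simp [inner_add_left, inner_sub_left, real_inner_smul_left]
  ring

/-- The inequality obtained by combining the sub- and supersolution conditions at a maximum of the
doubled functional. -/
lemma IsViscSubsol.hamiltonian_gap {H u₁₀ u₂₀ : E → ℝ} {u₁ u₂ : ℝ × E → ℝ}
    (h₁ : IsViscSubsol H u₁₀ u₁) (h₂ : IsViscSupersol H u₂₀ u₂)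
    {A B a k t₀ : ℝ} {p q : ℝ × E} (hp : p ∈ PiDom E) (hq : q ∈ PiDom E)
    (hmax : IsLocalMaxOn (fun z => u₁ z - penalty A B a k t₀ q z) (PiDom E) p)
    (hmin : IsLocalMinOn (fun z => u₂ z + penalty A B a k t₀ p z) (PiDom E) q) :
    a * k * Real.exp (k * (p.1 - t₀)) + a * k * Real.exp (k * (q.1 - t₀)) ≤
      H ((2 * A) • (p.2 - q.2) - (2 * B) • q.2) - H ((2 * A) • (p.2 - q.2) + (2 * B) • p.2) := by
  have hsub := h₁.2.2 p hp (2 * A * (p.1 - q.1) + a * k * Real.exp (k * (p.1 - t₀)),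
    (2 * A) • (p.2 - q.2) + (2 * B) • p.2)
    ⟨_, contDiff_penalty A B a k t₀ q, hmax, by simp [fderiv_penalty_apply],
      fun w => by simp [fderiv_penalty_apply]⟩
  have hsup := h₂.2.2 q hq (-(2 * A * (q.1 - p.1) + a * k * Real.exp (k * (q.1 - t₀))),
    (2 * A) • (p.2 - q.2) - (2 * B) • q.2)
    ⟨fun z => -penalty A B a k t₀ p z, (contDiff_penalty A B a k t₀ p).neg,
      by simpa only [sub_neg_eq_add] using hmin, by
        rw [fderiv_fun_neg]; simp [fderiv_penalty_apply], fun w => by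
        rw [fderiv_fun_neg, neg_apply, fderiv_penalty_apply]
        simp only [mul_zero, zero_add, ← inner_neg_left]
        congr 1
        module⟩
  dsimp only at hsub hsup
  linarith

/-- A continuous function on a product of strips attains its maximum, provided it is positive
somewhere and negative outside a compact cylinder. -/
lemma exists_isMaxOn_strip [FiniteDimensional ℝ E] {T R : ℝ} {Φ : (ℝ × E) × (ℝ × E) → ℝ}
    {p₀ : ℝ × E}
    (hΦ : ContinuousOn Φ ((Icc 0 T ×ˢ univ) ×ˢ (Icc 0 T ×ˢ univ)))
    (hp₀ : p₀ ∈ Icc 0 T ×ˢ Metric.closedBall (0 : E) R) (hpos : 0 ≤ Φ (p₀, p₀))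
    (hneg : ∀ p ∈ Icc 0 T ×ˢ (univ : Set E), ∀ q ∈ Icc 0 T ×ˢ (univ : Set E),
      R < ‖p.2‖ ∨ R < ‖q.2‖ → Φ (p, q) < 0) :
    ∃ p ∈ Icc 0 T ×ˢ (univ : Set E), ∃ q ∈ Icc 0 T ×ˢ (univ : Set E),
      ∀ p' ∈ Icc 0 T ×ˢ (univ : Set E), ∀ q' ∈ Icc 0 T ×ˢ (univ : Set E),
        Φ (p', q') ≤ Φ (p, q) := by
  have hK : IsCompact (Icc 0 T ×ˢ Metric.closedBall (0 : E) R) :=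
    isCompact_Icc.prod (isCompact_closedBall 0 R)
  have hsub : Icc 0 T ×ˢ Metric.closedBall (0 : E) R ⊆ Icc 0 T ×ˢ (univ : Set E) :=
    prod_mono_right (subset_univ _)
  obtain ⟨⟨p, q⟩, ⟨hp, hq⟩, hm⟩ := (hK.prod hK).exists_isMaxOn ⟨(p₀, p₀), hp₀, hp₀⟩
    (hΦ.mono (prod_mono hsub hsub))
  refine ⟨p, hsub hp, q, hsub hq, fun p' hp' q' hq' => ?_⟩
  by_cases h : R < ‖p'.2‖ ∨ R < ‖q'.2‖
  · exact (hneg p' hp' q' hq' h).le.trans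
      (hpos.trans (hm (show (p₀, p₀) ∈ _ from ⟨hp₀, hp₀⟩)))
  · push Not at h
    exact hm (show (p', q') ∈ _ from
      ⟨⟨hp'.1, by simpa using h.1⟩, ⟨hq'.1, by simpa using h.2⟩⟩)

set_option maxHeartbeats 1000000 in
/-- **Comparison principle** (Theorem 1): if `u₁` is a viscosity subsolution and `u₂` a viscosity
supersolution of `u_t + H(∇ₓu) = 0` with initial data `u₁₀ ≤ u₂₀`, then `u₁ ≤ u₂` on `Π`. -/
theorem comparison_principle {n : ℕ} (H : EuclideanSpace ℝ (Fin n) → ℝ) (hH : Continuous H)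
    (u₁₀ u₂₀ : EuclideanSpace ℝ (Fin n) → ℝ) (h₁₀ : IsBUC u₁₀) (h₂₀ : IsBUC u₂₀)
    (u₁ u₂ : ℝ × EuclideanSpace ℝ (Fin n) → ℝ)
    (h₁ : IsViscSubsol H u₁₀ u₁) (h₂ : IsViscSupersol H u₂₀ u₂)
    (hle : ∀ x, u₁₀ x ≤ u₂₀ x) :
    ∀ t : ℝ, 0 < t → ∀ x : EuclideanSpace ℝ (Fin n), u₁ (t, x) ≤ u₂ (t, x) := by
  intro t₀ ht₀ x₀
  by_contra! hlt
  set d := u₁ (t₀, x₀) - u₂ (t₀, x₀) with hd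
  have hdpos : 0 < d := by linarith
  have hinit : ∀ x, u₁ (0, x) ≤ u₂ (0, x) := fun x =>
    (h₁.2.1 x).trans ((hle x).trans (h₂.2.1 x))
  set S : Set (ℝ × EuclideanSpace ℝ (Fin n)) := Icc 0 (t₀ + 1) ×ˢ univ
  have hSL : S ⊆ Ico 0 (t₀ + 2) ×ˢ univ :=
    prod_mono_left (Icc_subset_Ico_right (by linarith))
  obtain ⟨⟨M₁, hM₁⟩, huc₁⟩ := h₁.1.2 (t₀ + 2) (by linarith)
  obtain ⟨⟨M₂, hM₂⟩, huc₂⟩ := h₂.1.2 (t₀ + 2) (by linarith)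
  obtain ⟨M, hMpos, hM⟩ : ∃ M : ℝ, 0 < M ∧ ∀ p ∈ S, ∀ q ∈ S, u₁ p - u₂ q ≤ M := by
    refine ⟨|M₁| + |M₂| + 1, by positivity, fun p hp q hq => ?_⟩
    linarith [abs_le.1 (hM₁ p (hSL hp)), abs_le.1 (hM₂ q (hSL hq)), le_abs_self M₁,
      le_abs_self M₂]
  -- moduli of continuity, which control the behaviour at the initial time
  obtain ⟨η₁, hη₁, hc₁⟩ := Metric.uniformContinuousOn_iff.1 huc₁ (d / 2) (by positivity)
  obtain ⟨η₂, hη₂, hc₂⟩ := Metric.uniformContinuousOn_iff.1 huc₂ (d / 2) (by positivity)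
  set η := min η₁ η₂
  have hηpos : 0 < η := lt_min hη₁ hη₂
  obtain ⟨A, hA, hAη⟩ : ∃ A : ℝ, 0 < A ∧ M < A * η ^ 2 :=
    ⟨(M + 1) / η ^ 2, by positivity, by field_simp; linarith⟩
  -- the time barrier
  obtain ⟨k, hk, hkM⟩ : ∃ k : ℝ, 0 < k ∧ M < d / 8 * Real.exp k := by
    refine ⟨8 * M / d, by positivity, ?_⟩
    have h := mul_le_mul_of_nonneg_left (Real.add_one_le_exp (8 * M / d))
      (show 0 ≤ d / 8 by positivity)
    have h' : d / 8 * (8 * M / d + 1) = M + d / 8 := by field_simp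
    linarith
  set c := d / 8 * k * Real.exp (k * (0 - t₀)) with hcdef
  have hcpos : 0 < c := by positivity
  have hbar : ∀ t, 0 ≤ t → c ≤ d / 8 * k * Real.exp (k * (t - t₀)) := fun t ht => by
    rw [hcdef]; gcongr
  -- the modulus of continuity of the Hamiltonian on a large ball
  obtain ⟨θ, hθ, hcH⟩ := Metric.uniformContinuousOn_iff.1
    ((isCompact_closedBall (0 : EuclideanSpace ℝ (Fin n))
      (2 * A * η + 1)).uniformContinuousOn_of_continuous hH.continuousOn) c hcpos
  obtain ⟨B, hB, hBθ, hB1, hBx⟩ : ∃ B : ℝ, 0 < B ∧ 4 * B * M < (θ / 2) ^ 2 ∧ 4 * B * M < 1 ^ 2 ∧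
      2 * B * ‖x₀‖ ^ 2 ≤ d / 4 := by
    have hev : ∀ᶠ B in 𝓝[>] (0 : ℝ), 4 * B * M < (θ / 2) ^ 2 ∧ 4 * B * M < 1 ^ 2 ∧
        2 * B * ‖x₀‖ ^ 2 < d / 4 := by
      refine eventually_nhdsWithin_of_eventually_nhds (Eventually.and ?_ (Eventually.and ?_ ?_)) <;>
      · refine ContinuousAt.eventually_lt (by fun_prop) continuousAt_const ?_
        simp <;> positivity
    obtain ⟨B, ⟨h1, h2, h3⟩, hB⟩ := (hev.and self_mem_nhdsWithin).exists
    exact ⟨B, hB, h1, h2, h3.le⟩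
  obtain ⟨R, hRx, hR, hBR⟩ : ∃ R : ℝ, ‖x₀‖ ≤ R ∧ 0 ≤ R ∧ M ≤ B * R ^ 2 := by
    refine ⟨M / B + 1 + ‖x₀‖, ?_, by positivity, ?_⟩
    · have : 0 < M / B := by positivity
      linarith
    · have h1 : (1 : ℝ) ≤ M / B + 1 + ‖x₀‖ := by
        have : 0 < M / B := by positivity
        linarith [norm_nonneg x₀]
      have h2 : M = B * (M / B) := by field_simp
      have h3 : M / B ≤ (M / B + 1 + ‖x₀‖) ^ 2 := by nlinarith [norm_nonneg x₀]
      calc M = B * (M / B) := h2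
        _ ≤ _ := by gcongr
  let g : ℝ → ℝ := fun t => d / 8 * Real.exp (k * (t - t₀))
  have hgpos : ∀ t, 0 < g t := fun t => by positivity
  have hgT : M < g (t₀ + 1) := by simpa [g] using hkM
  have hg₀ : g t₀ = d / 8 := by simp [g]
  let Φ : (ℝ × EuclideanSpace ℝ (Fin n)) × (ℝ × EuclideanSpace ℝ (Fin n)) → ℝ := fun z =>
    u₁ z.1 - u₂ z.2 - A * ((z.1.1 - z.2.1) ^ 2 + ‖z.1.2 - z.2.2‖ ^ 2)
      - B * ‖z.1.2‖ ^ 2 - B * ‖z.2.2‖ ^ 2 - g z.1.1 - g z.2.1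
  have hΦc : ContinuousOn Φ (S ×ˢ S) := by
    have hS0 : S ⊆ Ici 0 ×ˢ univ := prod_mono_left Icc_subset_Ici_self
    have e₁ : ContinuousOn (fun z : (ℝ × EuclideanSpace ℝ (Fin n)) ×
        (ℝ × EuclideanSpace ℝ (Fin n)) => u₁ z.1) (S ×ˢ S) :=
      (h₁.1.1.mono hS0).comp continuousOn_fst fun z hz => hz.1
    have e₂ : ContinuousOn (fun z : (ℝ × EuclideanSpace ℝ (Fin n)) ×
        (ℝ × EuclideanSpace ℝ (Fin n)) => u₂ z.2) (S ×ˢ S) :=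
      (h₂.1.1.mono hS0).comp continuousOn_snd fun z hz => hz.2
    have e₃ : Continuous (fun z : (ℝ × EuclideanSpace ℝ (Fin n)) ×
        (ℝ × EuclideanSpace ℝ (Fin n)) => A * ((z.1.1 - z.2.1) ^ 2 + ‖z.1.2 - z.2.2‖ ^ 2)
          + B * ‖z.1.2‖ ^ 2 + B * ‖z.2.2‖ ^ 2 + g z.1.1 + g z.2.1) := by
      simp only [g]
      fun_prop
    exact ((e₁.sub e₂).sub e₃.continuousOn).congr fun z _ => by
      simp only [Φ, Pi.sub_apply]
      ring
  have hp₀S : (t₀, x₀) ∈ S := ⟨⟨ht₀.le, by simp⟩, trivial⟩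
  have hΦ₀ : d / 2 ≤ Φ ((t₀, x₀), (t₀, x₀)) := by
    simp only [Φ, hg₀, sub_self, norm_zero]
    nlinarith
  obtain ⟨p, hp, q, hq, hmax⟩ := exists_isMaxOn_strip (R := R) hΦc
    (p₀ := (t₀, x₀)) ⟨hp₀S.1, by simpa using hRx⟩ (by linarith) (fun p hp q hq h => by
      have h1 := hM p hp q hq
      have h2 : 0 ≤ A * ((p.1 - q.1) ^ 2 + ‖p.2 - q.2‖ ^ 2) := by positivity
      have h3 : M ≤ B * ‖p.2‖ ^ 2 + B * ‖q.2‖ ^ 2 := by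
        rcases h with h | h
        · have : B * R ^ 2 ≤ B * ‖p.2‖ ^ 2 := by gcongr
          have : 0 ≤ B * ‖q.2‖ ^ 2 := by positivity
          linarith
        · have : B * R ^ 2 ≤ B * ‖q.2‖ ^ 2 := by gcongr
          have : 0 ≤ B * ‖p.2‖ ^ 2 := by positivity
          linarith
      simp only [Φ]
      linarith [hgpos p.1, hgpos q.1])
  -- properties of the maximum point
  have hval : d / 2 ≤ Φ (p, q) := hΦ₀.trans (hmax _ hp₀S _ hp₀S)
  have hMpq := hM p hp q hq
  have hgp := hgpos p.1
  have hgq := hgpos q.1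
  have hAt : 0 ≤ A * (p.1 - q.1) ^ 2 := by positivity
  have hAx : 0 ≤ A * ‖p.2 - q.2‖ ^ 2 := by positivity
  have hBp : 0 ≤ B * ‖p.2‖ ^ 2 := by positivity
  have hBq : 0 ≤ B * ‖q.2‖ ^ 2 := by positivity
  simp only [Φ, mul_add] at hval
  have hdt : |p.1 - q.1| < η := by
    refine abs_lt_of_sq_lt_sq ?_ hηpos.le
    exact lt_of_mul_lt_mul_left (by linarith) hA.le
  have hdx : ‖p.2 - q.2‖ < η := by
    refine lt_of_pow_lt_pow_left₀ 2 hηpos.le ?_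
    exact lt_of_mul_lt_mul_left (by linarith) hA.le
  have hp1 : 0 < p.1 := by
    refine lt_of_le_of_ne hp.1.1 fun h0 => ?_
    have h0S : ((0 : ℝ), p.2) ∈ S := ⟨⟨le_rfl, by linarith⟩, trivial⟩
    have hpe : p = (0, p.2) := Prod.ext h0.symm rfl
    have h := hc₂ (0, p.2) (hSL h0S) q (hSL hq) (by
      rw [← hpe, Prod.dist_eq]
      exact (max_lt (by rwa [Real.dist_eq]) (by rwa [dist_eq_norm])).trans_le (min_le_right _ _))
    rw [Real.dist_eq] at h
    have h' := hinit p.2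
    rw [← hpe] at h h'
    linarith [le_abs_self (u₂ p - u₂ q)]
  have hq1 : 0 < q.1 := by
    refine lt_of_le_of_ne hq.1.1 fun h0 => ?_
    have h0S : ((0 : ℝ), q.2) ∈ S := ⟨⟨le_rfl, by linarith⟩, trivial⟩
    have hqe : q = (0, q.2) := Prod.ext h0.symm rfl
    have h := hc₁ p (hSL hp) (0, q.2) (hSL h0S) (by
      rw [← hqe, Prod.dist_eq]
      exact (max_lt (by rwa [Real.dist_eq]) (by rwa [dist_eq_norm])).trans_le (min_le_left _ _))
    rw [Real.dist_eq] at h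
    have h' := hinit q.2
    rw [← hqe] at h h'
    linarith [le_abs_self (u₁ p - u₁ q)]
  have hpT : p.1 < t₀ + 1 := by
    refine lt_of_le_of_ne hp.1.2 fun h => ?_
    rw [h] at hval
    rw [h] at hAt
    linarith
  have hqT : q.1 < t₀ + 1 := by
    refine lt_of_le_of_ne hq.1.2 fun h => ?_
    rw [h] at hval
    rw [h] at hAt
    linarith
  have hnhds : ∀ z : ℝ × EuclideanSpace ℝ (Fin n), 0 < z.1 → z.1 < t₀ + 1 →
      ∀ᶠ w in 𝓝[PiDom (EuclideanSpace ℝ (Fin n))] z, w ∈ S := fun z h0 hT =>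
    mem_nhdsWithin_of_mem_nhds (prod_mem_nhds (Icc_mem_nhds h0 hT) univ_mem)
  have hgap := h₁.hamiltonian_gap h₂ (A := A) (B := B) (a := d / 8) (k := k) (t₀ := t₀)
    (p := p) (q := q) ⟨hp1, trivial⟩ ⟨hq1, trivial⟩
    (by
      filter_upwards [hnhds p hp1 hpT] with z hz
      have h : ∀ w, u₁ w - penalty A B (d / 8) k t₀ q w =
          Φ (w, q) + (u₂ q + B * ‖q.2‖ ^ 2 + g q.1) := fun w => by
        simp only [Φ, g, penalty]
        ring
      rw [h, h]
      exact add_le_add_left (hmax z hz q hq) _)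
    (by
      filter_upwards [hnhds q hq1 hqT] with z hz
      have h : ∀ w, u₂ w + penalty A B (d / 8) k t₀ p w =
          (u₁ p - B * ‖p.2‖ ^ 2 - g p.1) - Φ (p, w) := fun w => by
        simp only [Φ, g, penalty, norm_sub_rev p.2]
        ring
      rw [h, h]
      exact sub_le_sub_left (hmax p hp z hz) _)
  have hsmall : ∀ x : EuclideanSpace ℝ (Fin n), B * ‖x‖ ^ 2 ≤ M →
      ‖(2 * B) • x‖ < θ / 2 ∧ ‖(2 * B) • x‖ < 1 := fun x hx => by
    have hsq : ‖(2 * B) • x‖ ^ 2 ≤ 4 * B * M := by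
      rw [norm_smul, Real.norm_of_nonneg (by positivity)]
      nlinarith
    exact ⟨lt_of_pow_lt_pow_left₀ 2 (by positivity) (hsq.trans_lt hBθ),
      lt_of_pow_lt_pow_left₀ 2 one_pos.le (hsq.trans_lt hB1)⟩
  have hsp := hsmall p.2 (by linarith)
  have hsq := hsmall q.2 (by linarith)
  have hslope : ‖(2 * A) • (p.2 - q.2)‖ ≤ 2 * A * η := by
    rw [norm_smul, Real.norm_of_nonneg (by positivity)]
    gcongr
  have hHlt := hcH ((2 * A) • (p.2 - q.2) - (2 * B) • q.2)
    (mem_closedBall_zero_iff.2 ((norm_sub_le _ _).trans (by linarith)))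
    ((2 * A) • (p.2 - q.2) + (2 * B) • p.2)
    (mem_closedBall_zero_iff.2 ((norm_add_le _ _).trans (by linarith)))
    (by
      rw [dist_comm, dist_eq_norm, add_sub_sub_cancel]
      exact (norm_add_le _ _).trans_lt (by linarith))
  rw [Real.dist_eq] at hHlt
  linarith [le_abs_self (H ((2 * A) • (p.2 - q.2) - (2 * B) • q.2) -
    H ((2 * A) • (p.2 - q.2) + (2 * B) • p.2)), hbar p.1 hp1.le, hbar q.1 hq1.le]
end
end

section
/- Necessity of the non-degeneracy condition: Let H∈C(ℝⁿ), ξ∈ℝⁿ with ξ≠0, δ>0 and α∈ℝ be such that H(sξ)=αs for all |s|≤δ. Then the function u(t,x)=(δ/(2π))·sin(2π(ξ·x−αt)) is continuously differentiable on Π̄, satisfies u_t(t,x)+H(∇_x u(t,x))=0 at every point of Π, has initial value u(0,x)=(δ/(2π))·sin(2π ξ·x), and u(t,·) does not converge uniformly on ℝⁿ to a constant as t→+∞. -/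
open Set Filter Topology RealInnerProductSpace MeasureTheory

noncomputable section

variable {E : Type*} [NormedAddCommGroup E] [InnerProductSpace ℝ E]

theorem hasGradientAt_sin_wave {F : Type*} [NormedAddCommGroup F] [InnerProductSpace ℝ F]
    [CompleteSpace F] (δ α t : ℝ) (ξ x : F) :
    HasGradientAt (fun y : F => δ / (2 * Real.pi) *
        Real.sin (2 * Real.pi * (⟪ξ, y⟫ - α * t)))
      ((δ * Real.cos (2 * Real.pi * (⟪ξ, x⟫ - α * t))) • ξ) x := by
  rw [hasGradientAt_iff_hasFDerivAt]
  have h := (((((innerSL ℝ ξ).hasFDerivAt (x := x)).sub_const (α * t)).const_mul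
    (2 * Real.pi)).sin).const_mul (δ / (2 * Real.pi))
  refine h.congr_fderiv ?_
  ext y
  simp
  field_simp

theorem hasDerivAt_sin_wave (δ α a t : ℝ) :
    HasDerivAt (fun τ : ℝ => δ / (2 * Real.pi) * Real.sin (2 * Real.pi * (a - α * τ)))
      (-(α * (δ * Real.cos (2 * Real.pi * (a - α * t))))) t := by
  have h := ((((((hasDerivAt_id t).const_mul α).const_sub a).const_mul
    (2 * Real.pi)).sin).const_mul (δ / (2 * Real.pi)))
  refine h.congr_deriv ?_
  simp
  field_simp

/-- **Necessity of the non-degeneracy condition**: if `H(sξ) = αs` for `|s| ≤ δ` with `ξ ≠ 0`,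
`δ > 0`, then `u(t,x) = (δ/2π)·sin(2π(ξ·x − αt))` is a `C¹` classical solution of
`u_t + H(∇ₓu) = 0` on `Π` with initial value `(δ/2π)·sin(2π ξ·x)`, and `u(t,·)` does not
converge uniformly to any constant as `t → +∞`. -/
theorem nondegeneracy_necessary {n : ℕ} (H : EuclideanSpace ℝ (Fin n) → ℝ) (hH : Continuous H)
    (ξ : EuclideanSpace ℝ (Fin n)) (hξ : ξ ≠ 0) (δ : ℝ) (hδ : 0 < δ) (α : ℝ)
    (hlin : ∀ s : ℝ, |s| ≤ δ → H (s • ξ) = α * s)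
    (u : ℝ → EuclideanSpace ℝ (Fin n) → ℝ)
    (hu : ∀ t x, u t x = δ / (2 * Real.pi) * Real.sin (2 * Real.pi * (⟪ξ, x⟫ - α * t))) :
    ContDiff ℝ 1 (fun p : ℝ × EuclideanSpace ℝ (Fin n) => u p.1 p.2) ∧
    (∀ t : ℝ, 0 < t → ∀ x : EuclideanSpace ℝ (Fin n),
      deriv (fun τ => u τ x) t + H (gradient (u t) x) = 0) ∧
    (∀ x, u 0 x = δ / (2 * Real.pi) * Real.sin (2 * Real.pi * ⟪ξ, x⟫)) ∧
    ¬ ∃ c : ℝ, ∀ ε : ℝ, 0 < ε → ∃ T : ℝ, ∀ t ≥ T, ∀ x, |u t x - c| ≤ ε := by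
  obtain rfl : u = fun t x => δ / (2 * Real.pi) * Real.sin (2 * Real.pi * (⟪ξ, x⟫ - α * t)) := by
    funext t x
    exact hu t x
  refine ⟨?_, fun t _ x => ?_, fun x => by simp, ?_⟩
  · have h : ContDiff ℝ 1 fun p : ℝ × EuclideanSpace ℝ (Fin n) => ⟪ξ, p.2⟫ :=
      contDiff_const.inner ℝ contDiff_snd
    fun_prop
  · rw [(hasDerivAt_sin_wave δ α ⟪ξ, x⟫ t).deriv, (hasGradientAt_sin_wave δ α t ξ x).gradient,
      hlin]
    · ring
    · rw [abs_mul, abs_of_pos hδ]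
      exact mul_le_of_le_one_right hδ.le (Real.abs_cos_le_one _)
  · rintro ⟨c, hc⟩
    have hA : 0 < δ / (2 * Real.pi) := by positivity
    obtain ⟨T, hT⟩ := hc (δ / (2 * Real.pi) / 2) (half_pos hA)
    have hξ' : ⟪ξ, ξ⟫ ≠ 0 := inner_self_ne_zero.mpr hξ
    have key : ∀ r : ℝ, |δ / (2 * Real.pi) * Real.sin (2 * Real.pi * r) - c| ≤
        δ / (2 * Real.pi) / 2 := by
      intro r
      have h := hT T le_rfl (((r + α * T) / ⟪ξ, ξ⟫) • ξ)
      simpa only [inner_smul_right, div_mul_cancel₀ _ hξ', add_sub_cancel_right] using h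
    have h₁ := key (1 / 4)
    have h₂ := key (-(1 / 4))
    rw [show 2 * Real.pi * (1 / 4) = Real.pi / 2 by ring, Real.sin_pi_div_two] at h₁
    rw [show 2 * Real.pi * (-(1 / 4)) = -(Real.pi / 2) by ring, Real.sin_neg,
      Real.sin_pi_div_two] at h₂
    linarith [(abs_le.mp h₁).2, (abs_le.mp h₂).1]
end
end

section
/- Periodic case with coercive hamiltonian: Let H∈C(ℝⁿ) be convex with H(0)=0, satisfying the coercivity condition H(v)/|v| → +∞ as |v|→∞, and the non-degeneracy condition: for every nonzero ξ∈ℤⁿ, the function s↦H(sξ) is not affine on any interval (−δ,δ), δ>0. Let u₀∈C(ℝⁿ) be ℤⁿ-periodic (u₀(x+e)=u₀(x) for all e∈ℤⁿ). Then the viscosity solution u of u_t+H(∇_x u)=0, u(0,·)=u₀, satisfies u(t,·) ⇉ c uniformly on ℝⁿ as t→+∞, where c = min_x u₀(x). -/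
open Set Filter Topology RealInnerProductSpace MeasureTheory

noncomputable section

variable {E : Type*} [NormedAddCommGroup E] [InnerProductSpace ℝ E]

/-- A linear functional on a line lying below a continuous convex function `f` extends to a
linear functional lying below `f`. -/
lemma exists_inner_le_of_line_le [CompleteSpace E] {f : E → ℝ} (hf : ConvexOn ℝ univ f)
    (hfc : Continuous f) (ξ : E) (M : ℝ) (h : ∀ s : ℝ, M * s ≤ f (s • ξ)) :
    ∃ z : E, (∀ p, ⟪z, p⟫ ≤ f p) ∧ ⟪z, ξ⟫ = M := by
  have hepi : Convex ℝ {q : E × ℝ | f q.1 < q.2} := by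
    simpa using hf.convex_strict_epigraph
  have hopen : IsOpen {q : E × ℝ | f q.1 < q.2} :=
    isOpen_lt (hfc.comp continuous_fst) continuous_snd
  have hdisj : Disjoint {q : E × ℝ | f q.1 < q.2} (Submodule.span ℝ {((ξ, M) : E × ℝ)} : Set _) := by
    rw [Set.disjoint_left]
    rintro q hq hq'
    obtain ⟨s, rfl⟩ := Submodule.mem_span_singleton.1 hq'
    have := h s
    simp only [mem_ofPred_eq, Prod.smul_mk, smul_eq_mul] at hq
    linarith [mul_comm M s]
  obtain ⟨ℓ, c, hlt, hge⟩ := geometric_hahn_banach_open hepi hopen (Submodule.convex _) hdisj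
  have hline (s : ℝ) : c ≤ s * ℓ (ξ, M) := by
    have := hge (s • (ξ, M)) (Submodule.mem_span_singleton.2 ⟨s, rfl⟩)
    rwa [map_smul, smul_eq_mul] at this
  have hc : c ≤ 0 := by simpa using hline 0
  have hzero : ℓ (ξ, M) = 0 := by
    by_contra hne
    have := hline ((c - 1) / ℓ (ξ, M))
    rw [div_mul_cancel₀ _ hne] at this
    linarith
  set g : StrongDual ℝ E := ℓ.comp (ContinuousLinearMap.inl ℝ E ℝ) with hg
  set a : ℝ := ℓ (0, 1) with ha
  have hdecomp (p : E) (r : ℝ) : ℓ (p, r) = g p + r * a := by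
    have h1 : ((p, r) : E × ℝ) = (p, 0) + r • (0, 1) := by simp
    rw [h1, map_add, map_smul, smul_eq_mul]
    rfl
  have hneg (p : E) (r : ℝ) (hr : f p < r) : g p + r * a < 0 := by
    have := hlt (p, r) hr
    rw [hdecomp] at this
    linarith
  have ha0 : a < 0 := by
    have := hneg 0 (|f 0| + 1) (by linarith [le_abs_self (f 0)])
    rw [map_zero, zero_add] at this
    by_contra hcon
    have : 0 ≤ (|f 0| + 1) * a := mul_nonneg (by positivity) (not_lt.1 hcon)
    linarith
  refine ⟨(InnerProductSpace.toDual ℝ E).symm ((-a)⁻¹ • g), fun p => ?_, ?_⟩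
  · rw [InnerProductSpace.toDual_symm_apply]
    refine le_of_forall_gt_imp_ge_of_dense fun r hr => ?_
    have := hneg p r hr
    rw [smul_apply, smul_eq_mul, inv_mul_le_iff₀ (by linarith)]
    linarith
  · rw [InnerProductSpace.toDual_symm_apply, smul_apply, smul_eq_mul,
      inv_mul_eq_iff_eq_mul₀ (by linarith)]
    rw [hdecomp] at hzero
    linarith

/-- Finitely many linear functionals, each unbounded on a convex set, are simultaneously large
at some point of this set. -/
lemma exists_forall_abs_ge_of_unbounded {ι : Type*} {V : Type*} [AddCommGroup V] [Module ℝ V]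
    {S : Set V} (hS : Convex ℝ S) (hne : S.Nonempty) (L : ι → V →ₗ[ℝ] ℝ) (F : Finset ι)
    (hL : ∀ i ∈ F, ∀ M : ℝ, ∃ z ∈ S, M ≤ |L i z|) (M : ℝ) :
    ∃ z ∈ S, ∀ i ∈ F, M ≤ |L i z| := by
  classical
  induction F using Finset.induction_on generalizing M with
  | empty => obtain ⟨z, hz⟩ := hne; exact ⟨z, hz, by simp⟩
  | insert j F hj ih =>
    set N : ℕ := F.card + 1 with hN
    have hNpos : (0 : ℝ) < N := by positivity
    set M' : ℝ := |M| + 2 * |M| * N with hM'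
    obtain ⟨z, hz, hzF⟩ := ih (fun i hi => hL i (Finset.mem_insert_of_mem hi)) M'
    obtain ⟨y, hy, hyj⟩ := hL j (Finset.mem_insert_self _ _) M'
    by_contra! hcon
    have hmem (k : ℕ) (hk : k ∈ Finset.range (N + 1)) :
        (1 - (k / N : ℝ)) • z + (k / N : ℝ) • y ∈ S := by
      have : (k : ℝ) ≤ N := by exact_mod_cast Finset.mem_range_succ_iff.1 hk
      exact hS hz hy (sub_nonneg.2 ((div_le_one hNpos).2 this)) (by positivity) (by ring)
    have : Nonempty ι := ⟨j⟩
    choose! b hbF hb using fun k hk => hcon _ (hmem k hk)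
    obtain ⟨k, hk, l, hl, hkl, hbkl⟩ := Finset.exists_ne_map_eq_of_card_lt_of_maps_to
      (s := Finset.range (N + 1)) (t := insert j F) (f := b)
      (by rw [Finset.card_insert_of_notMem hj, Finset.card_range]; omega) (fun k hk => hbF k hk)
    have h1 := hb k hk
    have h2 := hb l hl
    rw [← hbkl] at h2
    set A := L (b k) z
    set B := L (b k) y
    simp only [map_add, map_smul, smul_eq_mul] at h1 h2
    have hend : M' ≤ |A| ∨ M' ≤ |B| := by
      rcases Finset.mem_insert.1 (hbF k hk) with h | h
      · right; simpa only [B, h] using hyj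
      · left; exact hzF _ h
    have hMM : M ≤ |M| := le_abs_self M
    have hkl1 : (1 : ℝ) ≤ |(k : ℝ) - l| := by
      have : (1 : ℤ) ≤ |(k : ℤ) - l| := Int.one_le_abs (by omega)
      exact_mod_cast this
    have hslope : |B - A| < 2 * |M| * N := by
      have h3 : |((k : ℝ) - l) / N * (B - A)| < 2 * |M| := by
        have e : ((k : ℝ) - l) / N * (B - A) = ((1 - (k / N : ℝ)) * A + (k / N : ℝ) * B)
          - ((1 - (l / N : ℝ)) * A + (l / N : ℝ) * B) := by ring
        rw [e]
        exact (abs_sub _ _).trans_lt (by linarith)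
      rw [abs_mul, abs_div, abs_of_pos hNpos, div_mul_eq_mul_div, div_lt_iff₀ hNpos] at h3
      nlinarith [abs_nonneg (B - A)]
    have hkN : (k : ℝ) / N ≤ 1 := by
      rw [div_le_one hNpos]; exact_mod_cast Finset.mem_range_succ_iff.1 hk
    have hk0 : (0 : ℝ) ≤ (k : ℝ) / N := by positivity
    set τ := (k : ℝ) / N
    rcases hend with h | h
    · have : |A| ≤ |(1 - τ) * A + τ * B| + |B - A| := by
        have e : A = ((1 - τ) * A + τ * B) - τ * (B - A) := by ring
        have h5 : |τ * (B - A)| ≤ |B - A| := by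
          rw [abs_mul, abs_of_nonneg hk0]; exact mul_le_of_le_one_left (abs_nonneg _) hkN
        calc |A| = |((1 - τ) * A + τ * B) - τ * (B - A)| := by rw [← e]
          _ ≤ _ := (abs_sub _ _).trans (by linarith)
      linarith
    · have : |B| ≤ |(1 - τ) * A + τ * B| + |B - A| := by
        have e : B = ((1 - τ) * A + τ * B) + (1 - τ) * (B - A) := by ring
        have h5 : |(1 - τ) * (B - A)| ≤ |B - A| := by
          rw [abs_mul, abs_of_nonneg (by linarith)]
          exact mul_le_of_le_one_left (abs_nonneg _) (by linarith)
        calc |B| = |((1 - τ) * A + τ * B) + (1 - τ) * (B - A)| := by rw [← e]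
          _ ≤ _ := (abs_add_le _ _).trans (by linarith)
      linarith

lemma IsBUCloc.neg {F : Type*} [NormedAddCommGroup F] {u : ℝ × F → ℝ} (hu : IsBUCloc u) :
    IsBUCloc (fun p => -u p) := by
  refine ⟨hu.1.neg, fun T hT => ?_⟩
  obtain ⟨⟨M, hM⟩, huc⟩ := hu.2 T hT
  exact ⟨⟨M, fun p hp => by simpa using hM p hp⟩, uniformContinuous_neg.comp_uniformContinuousOn huc⟩

lemma IsBUCloc.exists_bound {F : Type*} [NormedAddCommGroup F] {u : ℝ × F → ℝ} (hu : IsBUCloc u)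
    (T : ℝ) :
    ∃ B, 0 ≤ B ∧ ∀ t ∈ Icc 0 T, ∀ x, |u (t, x)| ≤ B := by
  obtain ⟨⟨M, hM⟩, -⟩ := hu.2 (|T| + 1) (by positivity)
  refine ⟨|M|, abs_nonneg _, fun t ht x => (hM (t, x) ⟨⟨ht.1, ?_⟩, mem_univ _⟩).trans (le_abs_self _)⟩
  exact ht.2.trans_lt (by linarith [le_abs_self T])

/-- A function growing linearly in space, corrected by an exponential barrier in time, touches a
function of class `BUC_loc` from above either at the initial time or at an interior point. -/
lemma IsBUCloc.exists_touching [FiniteDimensional ℝ E] {u ψ : ℝ × E → ℝ} (hu : IsBUCloc u)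
    (hψ : Continuous ψ) {T a b : ℝ} (hT : 0 ≤ T) (ha : 0 < a)
    (hgrow : ∀ t ∈ Icc 0 (T + 1), ∀ x, a * ‖x‖ - b ≤ ψ (t, x)) (y : E) {ε : ℝ} (hε : 0 < ε) :
    ∃ c > 0, ∃ t ≥ 0, ∃ x : E,
      u (T, y) - ψ (T, y) - ε ≤ u (t, x) - (ψ (t, x) + ε * Real.exp (c * (t - T))) ∧
      (0 < t → IsLocalMaxOn (fun q => u q - (ψ q + ε * Real.exp (c * (q.1 - T))))
        (PiDom E) (t, x)) := by
  obtain ⟨B, hB0, hB⟩ := hu.exists_bound (T + 1)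
  have hTm : T ∈ Icc 0 (T + 1) := ⟨hT, by linarith⟩
  set m : ℝ := u (T, y) - ψ (T, y) - ε with hm
  set D : ℝ := max (B + b - m) 0 + 1 with hD
  have hDpos : 0 < D := by positivity
  have hDm : B + b - m < D := by linarith [le_max_left (B + b - m) 0]
  set c : ℝ := D / ε with hc
  have hcpos : 0 < c := by positivity
  have hexp : D < ε * Real.exp c := by
    have := Real.add_one_lt_exp hcpos.ne'
    have h2 : ε * c = D := by rw [hc]; field_simp
    nlinarith
  set φ : ℝ × E → ℝ := fun q => ψ q + ε * Real.exp (c * (q.1 - T)) with hφ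
  have hφc : Continuous φ := by fun_prop
  set R : ℝ := max (D / a) ‖y‖ + 1 with hR
  have hDR : D < a * R := by
    have : D / a < R := by linarith [le_max_left (D / a) ‖y‖]
    rwa [div_lt_iff₀ ha, mul_comm] at this
  have hyR : ‖y‖ ≤ R := by linarith [le_max_right (D / a) ‖y‖]
  have hR0 : 0 ≤ R := (norm_nonneg y).trans hyR
  have hKc : IsCompact (Icc 0 (T + 1) ×ˢ Metric.closedBall (0 : E) R) :=
    isCompact_Icc.prod (isCompact_closedBall _ _)
  have hyK : (T, y) ∈ Icc 0 (T + 1) ×ˢ Metric.closedBall (0 : E) R :=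
    ⟨hTm, by simpa using hyR⟩
  obtain ⟨⟨t, x⟩, ⟨ht, hx⟩, hmax⟩ := hKc.exists_isMaxOn ⟨_, hyK⟩
    (f := fun q => u q - φ q)
    ((hu.1.mono fun q hq => ⟨hq.1.1, mem_univ _⟩).sub hφc.continuousOn)
  have hval : m ≤ u (t, x) - φ (t, x) := by
    have : u (T, y) - φ (T, y) ≤ u (t, x) - φ (t, x) := hmax hyK
    simp only [hφ, sub_self, mul_zero, Real.exp_zero, mul_one] at this ⊢
    linarith
  have hout (s : ℝ) (hs : s ∈ Icc 0 (T + 1)) (z : E) (hz : R < ‖z‖ ∨ s = T + 1) :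
      u (s, z) - φ (s, z) < m := by
    have h1 := hgrow s hs z
    have h2 := (abs_le.1 (hB s hs z)).2
    have h3 : 0 < ε * Real.exp (c * (s - T)) := by positivity
    simp only [hφ]
    rcases hz with hz | rfl
    · have := mul_lt_mul_of_pos_left hz ha
      linarith
    · have h4 : ε * Real.exp (c * (T + 1 - T)) = ε * Real.exp c := by simp
      have : 0 ≤ a * ‖z‖ := by positivity
      linarith
  have htT : t < T + 1 := lt_of_le_of_ne ht.2 fun h => absurd hval (not_le.2 (hout t ht x (Or.inr h)))
  refine ⟨c, hcpos, t, ht.1, x, hval, fun _ => ?_⟩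
  have hnear : {q : ℝ × E | q.1 < T + 1} ∈ 𝓝 (t, x) :=
    (isOpen_lt continuous_fst continuous_const).mem_nhds htT
  filter_upwards [mem_nhdsWithin_of_mem_nhds hnear, self_mem_nhdsWithin] with q hq hqP
  have hq1 : q.1 ∈ Icc 0 (T + 1) := ⟨le_of_lt hqP.1, le_of_lt hq⟩
  by_cases hqR : ‖q.2‖ ≤ R
  · exact hmax ⟨hq1, by simpa using hqR⟩
  · exact ((hout q.1 hq1 q.2 (Or.inl (not_le.1 hqR))).trans_le hval).le

/-- A subsolution grows at speed at most `ℓ` along a straight line of velocity `w` whenever the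
hamiltonian dominates the affine function `⟪w, ·⟫ - ℓ`. -/
lemma le_add_mul_of_subsol [FiniteDimensional ℝ E] {H : E → ℝ} {u : ℝ × E → ℝ}
    (hu : IsBUCloc u) (hsub : ∀ p ∈ PiDom E, ∀ sv ∈ superdiff u p, sv.1 + H sv.2 ≤ 0)
    {w : E} {ℓ : ℝ} (hw : ∀ p, ⟪w, p⟫ - ℓ ≤ H p) {T : ℝ} (hT : 0 ≤ T) (x₀ : E) :
    u (T, x₀ + T • w) ≤ u (0, x₀) + ℓ * T := by
  refine le_of_forall_pos_le_add fun η hη => ?_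
  obtain ⟨ε, hε, hεη⟩ : ∃ ε > 0, ε * (T + 2) ≤ η :=
    ⟨η / (T + 2), by positivity, by rw [div_mul_cancel₀]; positivity⟩
  obtain ⟨B, hB0, hB⟩ := hu.exists_bound 0
  have h0 : (0 : ℝ) ∈ Icc (0 : ℝ) 0 := ⟨le_rfl, le_rfl⟩
  obtain ⟨δ, hδ, hcont⟩ : ∃ δ > 0, ∀ x, ‖x - x₀‖ < δ → u (0, x) ≤ u (0, x₀) + ε := by
    have h1 := (hu.2 1 one_pos).2
    rw [Metric.uniformContinuousOn_iff] at h1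
    obtain ⟨δ, hδ, h⟩ := h1 ε hε
    refine ⟨δ, hδ, fun x hx => ?_⟩
    have := h (0, x) ⟨by simp, mem_univ _⟩ (0, x₀) ⟨by simp, mem_univ _⟩
      (by simpa [Prod.dist_eq, dist_eq_norm] using hx)
    rw [Real.dist_eq] at this
    linarith [(abs_lt.1 this).2]
  obtain ⟨K, hK, hKδ⟩ : ∃ K > 0, 2 * B ≤ K * δ ^ 2 :=
    ⟨(2 * B + 1) / δ ^ 2, by positivity, by rw [div_mul_cancel₀ _ (by positivity)]; linarith⟩
  set ψ : ℝ × E → ℝ := fun q => (ℓ + ε) * q.1 + K * ‖q.2 - x₀ - q.1 • w‖ ^ 2 with hψ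
  have hψd : ContDiff ℝ 1 ψ := by
    have : ContDiff ℝ 1 fun q : ℝ × E => ‖q.2 - x₀ - q.1 • w‖ ^ 2 :=
      ContDiff.norm_sq ℝ (by fun_prop)
    fun_prop
  have hgrow : ∀ t ∈ Icc 0 (T + 1), ∀ x,
      (2 * K) * ‖x‖ - (|ℓ + ε| * (T + 1) + K + 2 * K * (‖x₀‖ + (T + 1) * ‖w‖)) ≤ ψ (t, x) := by
    intro t ht x
    have h1 : -(|ℓ + ε| * (T + 1)) ≤ (ℓ + ε) * t := by
      have h2 : |(ℓ + ε) * t| ≤ |ℓ + ε| * (T + 1) := by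
        rw [abs_mul, abs_of_nonneg ht.1]
        exact mul_le_mul_of_nonneg_left ht.2 (abs_nonneg _)
      linarith [(abs_le.1 h2).1]
    have h3 : ‖x‖ ≤ ‖x - x₀ - t • w‖ + (‖x₀‖ + (T + 1) * ‖w‖) := by
      calc ‖x‖ = ‖(x - x₀ - t • w) + (x₀ + t • w)‖ := by congr 1; abel
        _ ≤ ‖x - x₀ - t • w‖ + (‖x₀‖ + ‖t • w‖) :=
          (norm_add_le _ _).trans (by gcongr; exact norm_add_le _ _)
        _ ≤ _ := by
          rw [norm_smul, Real.norm_of_nonneg ht.1]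
          gcongr
          exact ht.2
    simp only [hψ]
    nlinarith [mul_nonneg hK.le (sq_nonneg (‖x - x₀ - t • w‖ - 1)), mul_le_mul_of_nonneg_left h3 hK.le]
  obtain ⟨c, hc, t, ht, x, hle, hloc⟩ := hu.exists_touching hψd.continuous hT (by positivity)
    hgrow (x₀ + T • w) hε
  rcases ht.eq_or_lt with rfl | ht
  · have hψT : ψ (T, x₀ + T • w) = (ℓ + ε) * T := by simp [hψ]
    have hψ0 : ψ (0, x) = K * ‖x - x₀‖ ^ 2 := by simp [hψ]
    rw [hψT, hψ0] at hle
    have hexp : 0 < ε * Real.exp (c * (0 - T)) := by positivity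
    have hmain : u (0, x) - K * ‖x - x₀‖ ^ 2 ≤ u (0, x₀) + ε := by
      by_cases hx : ‖x - x₀‖ < δ
      · have := hcont x hx
        have : 0 ≤ K * ‖x - x₀‖ ^ 2 := by positivity
        linarith
      · have h4 : K * δ ^ 2 ≤ K * ‖x - x₀‖ ^ 2 := by
          have := not_lt.1 hx
          gcongr
        have := (abs_le.1 (hB 0 h0 x)).2
        have := (abs_le.1 (hB 0 h0 x₀)).1
        linarith
    linarith
  · exfalso
    set d : E := x - x₀ - t • w with hd
    set v : E := (2 * K) • d with hv
    have hder : HasFDerivAt (fun q : ℝ × E => ψ q + ε * Real.exp (c * (q.1 - T)))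
        (((ℓ + ε) • ContinuousLinearMap.fst ℝ ℝ E + K • (2 • (innerSL ℝ d).comp
          (ContinuousLinearMap.snd ℝ ℝ E - (ContinuousLinearMap.fst ℝ ℝ E).smulRight w))) +
          ε • (Real.exp (c * (t - T)) • (c • ContinuousLinearMap.fst ℝ ℝ E))) (t, x) := by
      have hf : HasFDerivAt (fun q : ℝ × E => q.1) (ContinuousLinearMap.fst ℝ ℝ E) (t, x) :=
        hasFDerivAt_fst
      have hs : HasFDerivAt (fun q : ℝ × E => q.2) (ContinuousLinearMap.snd ℝ ℝ E) (t, x) :=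
        hasFDerivAt_snd
      exact ((hf.const_mul _).add (((hs.sub_const x₀).sub (hf.smul_const w)).norm_sq.const_mul K)).add
        ((((hf.sub_const T).const_mul c).exp).const_mul ε)
    have := hsub (t, x) ⟨ht, mem_univ _⟩
      (ℓ + ε - ⟪w, v⟫ + ε * (Real.exp (c * (t - T)) * c), v)
      ⟨_, hψd.add (by fun_prop), hloc ht, by
        rw [hder.fderiv]
        simp [hv, inner_smul_right, real_inner_comm w]
        ring, fun z => by
        rw [hder.fderiv]
        simp [hv, inner_smul_left]
        ring⟩
    have h2 := hw v
    have h3 : 0 < ε * (Real.exp (c * (t - T)) * c) := by positivity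
    simp only at this
    linarith

/-- If `H 0 = 0`, constants lying below a supersolution at the initial time stay below it. -/
lemma le_of_supersol [FiniteDimensional ℝ E] {H : E → ℝ} (hH : Continuous H) (hH0 : H 0 = 0)
    {u : ℝ × E → ℝ} (hu : IsBUCloc u)
    (hsup : ∀ p ∈ PiDom E, ∀ sv ∈ subdiff u p, 0 ≤ sv.1 + H sv.2) {m : ℝ}
    (hm : ∀ x, m ≤ u (0, x)) {T : ℝ} (hT : 0 ≤ T) (y : E) : m ≤ u (T, y) := by
  refine le_of_forall_pos_le_add fun η hη => ?_
  obtain ⟨ε, hε, hεη⟩ : ∃ ε > 0, ε * (T + 2) ≤ η :=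
    ⟨η / (T + 2), by positivity, by rw [div_mul_cancel₀]; positivity⟩
  obtain ⟨r, hr, hHr⟩ : ∃ r > 0, ∀ v, ‖v‖ < r → H v < ε := by
    obtain ⟨r, hr, h⟩ := Metric.continuous_iff.1 hH 0 ε hε
    refine ⟨r, hr, fun v hv => ?_⟩
    have := h v (by simpa using hv)
    rw [hH0, Real.dist_eq, sub_zero] at this
    exact (abs_lt.1 this).2
  have hpos (x : E) : 0 < 1 + ‖x‖ ^ 2 := by positivity
  obtain ⟨δ, hδ, hδr, hδy⟩ : ∃ δ > 0, δ < r ∧ δ * √(1 + ‖y‖ ^ 2) ≤ ε := by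
    have hs : 0 < √(1 + ‖y‖ ^ 2) := Real.sqrt_pos.2 (hpos y)
    refine ⟨min (r / 2) (ε / √(1 + ‖y‖ ^ 2)), by positivity,
      (min_le_left _ _).trans_lt (by linarith), ?_⟩
    rw [← le_div_iff₀ hs]
    exact min_le_right _ _
  set ψ : ℝ × E → ℝ := fun q => ε * q.1 + δ * √(1 + ‖q.2‖ ^ 2) with hψ
  have hψd : ContDiff ℝ 1 ψ := by
    have : ContDiff ℝ 1 fun q : ℝ × E => √(1 + ‖q.2‖ ^ 2) :=
      ContDiff.sqrt (contDiff_const.add (contDiff_snd.norm_sq ℝ)) fun q => (hpos q.2).ne'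
    fun_prop
  have hsqrt (x : E) : ‖x‖ ≤ √(1 + ‖x‖ ^ 2) := Real.le_sqrt_of_sq_le (by linarith)
  have hgrow : ∀ t ∈ Icc 0 (T + 1), ∀ x, δ * ‖x‖ - 0 ≤ ψ (t, x) := by
    intro t ht x
    have h1 : 0 ≤ ε * t := mul_nonneg hε.le ht.1
    have h2 := mul_le_mul_of_nonneg_left (hsqrt x) hδ.le
    simp only [hψ]
    linarith
  obtain ⟨c, hc, t, ht, x, hle, hloc⟩ := hu.neg.exists_touching hψd.continuous hT hδ
    hgrow y hε
  rcases ht.eq_or_lt with rfl | ht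
  · have h1 : 0 < ε * Real.exp (c * (0 - T)) := by positivity
    have h2 : 0 ≤ δ * √(1 + ‖x‖ ^ 2) := by positivity
    have h3 := hm x
    simp only [hψ] at hle
    linarith
  · exfalso
    set s : ℝ := √(1 + ‖x‖ ^ 2) with hs
    have hs0 : 0 < s := Real.sqrt_pos.2 (hpos x)
    set v : E := -((δ / s) • x) with hv
    have hder : HasFDerivAt (fun q : ℝ × E => -(ψ q + ε * Real.exp (c * (q.1 - T))))
        (-((ε • ContinuousLinearMap.fst ℝ ℝ E + δ • ((1 / (2 * s)) • (2 • (innerSL ℝ x).comp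
          (ContinuousLinearMap.snd ℝ ℝ E)))) +
          ε • (Real.exp (c * (t - T)) • (c • ContinuousLinearMap.fst ℝ ℝ E)))) (t, x) := by
      have hf : HasFDerivAt (fun q : ℝ × E => q.1) (ContinuousLinearMap.fst ℝ ℝ E) (t, x) :=
        hasFDerivAt_fst
      have hsnd : HasFDerivAt (fun q : ℝ × E => q.2) (ContinuousLinearMap.snd ℝ ℝ E) (t, x) :=
        hasFDerivAt_snd
      exact (((hf.const_mul _).add (((hsnd.norm_sq.const_add 1).sqrt (hpos x).ne').const_mul δ)).add
        ((((hf.sub_const T).const_mul c).exp).const_mul ε)).neg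
    have hmin : IsLocalMinOn (fun q => u q - -(ψ q + ε * Real.exp (c * (q.1 - T))))
        (PiDom E) (t, x) := by
      filter_upwards [hloc ht] with q hq
      linarith
    have := hsup (t, x) ⟨ht, mem_univ _⟩
      (-(ε + ε * (Real.exp (c * (t - T)) * c)), v)
      ⟨_, (hψd.add (by fun_prop)).neg, hmin, by
        rw [hder.fderiv]
        simp, fun z => by
        rw [hder.fderiv]
        simp [hv, inner_smul_left]
        field_simp⟩
    have hvr : ‖v‖ < r := by
      rw [hv, norm_neg, norm_smul, Real.norm_of_nonneg (by positivity), div_mul_eq_mul_div]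
      refine lt_of_le_of_lt ?_ hδr
      rw [div_le_iff₀ hs0]
      exact mul_le_mul_of_nonneg_left (hsqrt x) hδ.le
    have h2 := hHr v hvr
    have h3 : 0 < ε * (Real.exp (c * (t - T)) * c) := by positivity
    simp only at this
    linarith

lemma mFourier_coe_apply {d : Type*} [Fintype d] (ξ : d → ℤ) (z : d → ℝ) :
    UnitAddTorus.mFourier ξ (fun i => ((z i : ℝ) : UnitAddCircle)) =
      Complex.exp (2 * Real.pi * Complex.I * ((∑ i, ξ i * z i : ℝ) : ℂ)) := by
  simp only [UnitAddTorus.mFourier, ContinuousMap.coe_mk, fourier_coe_apply, ← Complex.exp_sum]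
  congr 1
  push_cast
  rw [Finset.mul_sum]
  exact Finset.sum_congr rfl fun i _ => by simp; ring

lemma integral_mFourier_eq_zero {d : Type*} [Fintype d] (μ : Measure (UnitAddTorus d))
    [μ.IsAddLeftInvariant] {ξ : d → ℤ} (hξ : ξ ≠ 0) : ∫ x, UnitAddTorus.mFourier ξ x ∂μ = 0 := by
  classical
  obtain ⟨j, hj⟩ := Function.ne_iff.1 hξ
  have hj' : (ξ j : ℝ) ≠ 0 := by exact_mod_cast hj
  set g : UnitAddTorus d :=
    fun i => ((Pi.single (M := fun _ => ℝ) j (1 / (2 * (ξ j : ℝ))) i : ℝ) : UnitAddCircle) with hg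
  have hsum : ∑ i, (ξ i : ℝ) * Pi.single (M := fun _ => ℝ) j (1 / (2 * (ξ j : ℝ))) i = 1 / 2 := by
    rw [Finset.sum_eq_single j (fun i _ hi => by simp [hi]) (by simp)]
    simp only [Pi.single_eq_same]
    field_simp
  have hgval : UnitAddTorus.mFourier ξ g = -1 := by
    rw [hg, mFourier_coe_apply, hsum, ← Complex.exp_pi_mul_I]
    congr 1
    push_cast
    ring
  have hadd (x : UnitAddTorus d) :
      UnitAddTorus.mFourier ξ (g + x) = -UnitAddTorus.mFourier ξ x := by
    have : UnitAddTorus.mFourier ξ (g + x) =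
        UnitAddTorus.mFourier ξ g * UnitAddTorus.mFourier ξ x := by
      simp only [UnitAddTorus.mFourier, ContinuousMap.coe_mk, Pi.add_apply, ← Finset.prod_mul_distrib,
        fourier_apply, smul_add, AddCircle.toCircle_add, Circle.coe_mul]
    rw [this, hgval, neg_one_mul]
  have h := integral_add_left_eq_self (μ := μ) (fun x => UnitAddTorus.mFourier ξ x) g
  simp only [hadd, integral_neg] at h
  exact self_eq_neg.1 h.symm

lemma norm_integral_exp_le {a : ℝ} (ha : a ≠ 0) :
    ‖∫ τ in (0 : ℝ)..1, Complex.exp (2 * Real.pi * Complex.I * a * τ)‖ ≤ 1 / |a| := by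
  have hc : (2 * Real.pi * Complex.I * a : ℂ) ≠ 0 := by simp [ha, Real.pi_ne_zero]
  rw [integral_exp_mul_complex hc, norm_div]
  have hn : ‖(2 * Real.pi * Complex.I * a : ℂ)‖ = 2 * Real.pi * |a| := by
    simp [abs_of_pos Real.pi_pos]
  have h1 : ‖Complex.exp (2 * Real.pi * Complex.I * a * (1 : ℝ)) -
      Complex.exp (2 * Real.pi * Complex.I * a * (0 : ℝ))‖ ≤ 2 := by
    refine (norm_sub_le _ _).trans ?_
    have (b : ℝ) : ‖Complex.exp (2 * Real.pi * Complex.I * a * b)‖ = 1 := by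
      rw [show (2 * Real.pi * Complex.I * a * b : ℂ) = ((2 * Real.pi * a * b : ℝ) : ℂ) * Complex.I by
        push_cast; ring]
      exact Complex.norm_exp_ofReal_mul_I _
    rw [this, this]
    norm_num
  rw [hn, div_le_div_iff₀ (by positivity) (by positivity)]
  nlinarith [Real.pi_gt_three, abs_nonneg a]

/-- **Equidistribution of long segments** in the torus: if the directions `z k` become unbounded
against every nonzero character, the averages over the segments `[0, z k]` converge to the mean. -/
lemma tendsto_segment_average {d ι : Type*} [Fintype d] (μ : Measure (UnitAddTorus d))
    [IsProbabilityMeasure μ] [μ.IsAddLeftInvariant] {l : Filter ι} (z : ι → d → ℝ)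
    (hz : ∀ ξ : d → ℤ, ξ ≠ 0 → Tendsto (fun k => |∑ i, (ξ i : ℝ) * z k i|) l atTop)
    (f : C(UnitAddTorus d, ℂ)) :
    Tendsto (fun k => ∫ τ in (0 : ℝ)..1, f (fun i => ((τ * z k i : ℝ) : UnitAddCircle))) l
      (𝓝 (∫ x, f x ∂μ)) := by
  have hcont (f : C(UnitAddTorus d, ℂ)) (k : ι) :
      Continuous fun τ : ℝ => f (fun i => ((τ * z k i : ℝ) : UnitAddCircle)) := by
    refine f.continuous.comp (continuous_pi fun i => ?_)
    exact (AddCircle.continuous_mk' 1).comp (by fun_prop)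
  have hii (f : C(UnitAddTorus d, ℂ)) (k : ι) : IntervalIntegrable
      (fun τ : ℝ => f (fun i => ((τ * z k i : ℝ) : UnitAddCircle))) volume 0 1 :=
    (hcont f k).intervalIntegrable _ _
  have hint (f : C(UnitAddTorus d, ℂ)) : Integrable f μ := f.continuous.integrable_of_hasCompactSupport
    (HasCompactSupport.of_compactSpace _)
  have hspan : ∀ g ∈ Submodule.span ℂ (range (UnitAddTorus.mFourier (d := d))),
      Tendsto (fun k => ∫ τ in (0 : ℝ)..1, g (fun i => ((τ * z k i : ℝ) : UnitAddCircle))) l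
        (𝓝 (∫ x, g x ∂μ)) := by
    intro g hg
    induction hg using Submodule.span_induction with
    | mem g hg =>
      obtain ⟨ξ, rfl⟩ := hg
      by_cases hξ : ξ = 0
      · subst hξ
        simpa [UnitAddTorus.mFourier_zero] using tendsto_const_nhds
      · rw [integral_mFourier_eq_zero μ hξ]
        refine squeeze_zero_norm' ?_ (hz ξ hξ).inv_tendsto_atTop
        filter_upwards [(hz ξ hξ).eventually_gt_atTop 0] with k hk
        have hk' := abs_pos.1 hk
        refine (le_of_eq ?_).trans ((norm_integral_exp_le hk').trans (by simp))
        congr 2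
        ext τ
        rw [mFourier_coe_apply]
        congr 1
        have : ∑ i, (ξ i : ℝ) * (τ * z k i) = (∑ i, (ξ i : ℝ) * z k i) * τ := by
          rw [Finset.sum_mul]
          exact Finset.sum_congr rfl fun i _ => by ring
        rw [this]
        push_cast
        ring
    | zero => simpa using tendsto_const_nhds
    | add f g _ _ hf hg =>
      simp only [ContinuousMap.add_apply]
      rw [integral_add (hint f) (hint g)]
      refine (hf.add hg).congr fun k => ?_
      rw [intervalIntegral.integral_add (hii f k) (hii g k)]
    | smul a g _ hg =>
      simp only [ContinuousMap.smul_apply, intervalIntegral.integral_smul, integral_smul]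
      exact hg.const_smul a
  rw [Metric.tendsto_nhds]
  intro ε hε
  have hf : f ∈ closure (Submodule.span ℂ (range (UnitAddTorus.mFourier (d := d))) : Set _) := by
    have : f ∈ (Submodule.span ℂ (range (UnitAddTorus.mFourier (d := d)))).topologicalClosure := by
      rw [UnitAddTorus.span_mFourier_closure_eq_top]
      trivial
    exact this
  obtain ⟨g, hg, hfg⟩ := Metric.mem_closure_iff.1 hf (ε / 3) (by positivity)
  rw [dist_eq_norm] at hfg
  have hpt (x : UnitAddTorus d) : ‖f x - g x‖ ≤ ε / 3 := ((f - g).norm_coe_le_norm x).trans hfg.le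
  filter_upwards [Metric.tendsto_nhds.1 (hspan g hg) (ε / 3) (by positivity)] with k hk
  rw [dist_eq_norm] at hk ⊢
  have h1 : ‖(∫ τ in (0 : ℝ)..1, f (fun i => ((τ * z k i : ℝ) : UnitAddCircle))) -
      ∫ τ in (0 : ℝ)..1, g (fun i => ((τ * z k i : ℝ) : UnitAddCircle))‖ ≤ ε / 3 := by
    rw [← intervalIntegral.integral_sub (hii f k) (hii g k)]
    simpa using intervalIntegral.norm_integral_le_of_norm_le_const (C := ε / 3) (a := 0) (b := 1)
      (fun τ _ => hpt (fun i => ((τ * z k i : ℝ) : UnitAddCircle)))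
  have h2 : ‖(∫ x, g x ∂μ) - ∫ x, f x ∂μ‖ ≤ ε / 3 := by
    rw [← integral_sub (hint g) (hint f)]
    simpa using norm_integral_le_of_norm_le_const (μ := μ) (C := ε / 3)
      (ae_of_all _ fun x => (norm_sub_rev (g x) (f x)).trans_le (hpt x))
  set P := ∫ τ in (0 : ℝ)..1, f (fun i => ((τ * z k i : ℝ) : UnitAddCircle))
  set Q := ∫ τ in (0 : ℝ)..1, g (fun i => ((τ * z k i : ℝ) : UnitAddCircle))
  calc ‖P - ∫ x, f x ∂μ‖
      = ‖(P - Q) + (Q - ∫ x, g x ∂μ) + ((∫ x, g x ∂μ) - ∫ x, f x ∂μ)‖ := by congr 1; ring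
    _ ≤ ‖P - Q‖ + ‖Q - ∫ x, g x ∂μ‖ + ‖(∫ x, g x ∂μ) - ∫ x, f x ∂μ‖ := norm_add₃_le
    _ < ε := by linarith

/-- A convex set containing `0` on which every nonzero character of the torus is unbounded has
dense image in the torus. -/
lemma exists_norm_sub_sub_lt_of_unbounded {n : ℕ} {S : Set (EuclideanSpace ℝ (Fin n))}
    (hS : Convex ℝ S) (h0 : 0 ∈ S)
    (hunb : ∀ ξ : Fin n → ℤ, ξ ≠ 0 → ∀ M : ℝ, ∃ z ∈ S,
      M ≤ |⟪(WithLp.toLp 2 fun i => (ξ i : ℝ) : EuclideanSpace ℝ (Fin n)), z⟫|)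
    (θ : EuclideanSpace ℝ (Fin n)) {ρ : ℝ} (hρ : 0 < ρ) :
    ∃ z ∈ S, ∃ e : Fin n → ℤ, ‖θ - z - WithLp.toLp 2 (fun i => (e i : ℝ))‖ < ρ := by
  classical
  set q : EuclideanSpace ℝ (Fin n) → UnitAddTorus (Fin n) :=
    fun x i => ((x i : ℝ) : UnitAddCircle) with hq
  set r : ℝ := ρ / (√n + 1) with hr
  have hrpos : 0 < r := by positivity
  by_contra! hcon
  have hfar : ∀ z ∈ S, r ≤ dist (q z) (q θ) := by
    intro z hz
    by_contra! hlt
    refine (hcon z hz fun i => round (θ i - z i)).not_gt ?_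
    have hcoord (i : Fin n) : |θ i - z i - round (θ i - z i)| ≤ r := by
      have h1 := (dist_le_pi_dist (q z) (q θ) i).trans hlt.le
      rw [dist_comm, dist_eq_norm] at h1
      simp only [hq] at h1
      rwa [← AddCircle.coe_sub, UnitAddCircle.norm_eq] at h1
    rw [EuclideanSpace.norm_eq]
    calc √(∑ i, ‖(θ - z - WithLp.toLp 2 fun i => ((round (θ i - z i) : ℤ) : ℝ)) i‖ ^ 2)
        ≤ √(∑ _i : Fin n, r ^ 2) := by
          refine Real.sqrt_le_sqrt (Finset.sum_le_sum fun i _ => ?_)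
          exact pow_le_pow_left₀ (norm_nonneg _) (by simpa using hcoord i) 2
      _ = √n * r := by
          rw [Finset.sum_const, Finset.card_univ, Fintype.card_fin, nsmul_eq_mul,
            Real.sqrt_mul (by positivity), Real.sqrt_sq hrpos.le]
      _ < ρ := by
          rw [hr, mul_div_assoc', div_lt_iff₀ (by positivity)]
          nlinarith
  have hex (k : Finset (Fin n → ℤ) × ℕ) : ∃ z ∈ S, ∀ ξ ∈ k.1.erase 0,
      (k.2 : ℝ) ≤ |innerₛₗ ℝ (WithLp.toLp 2 fun i => (ξ i : ℝ) : EuclideanSpace ℝ (Fin n)) z| :=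
    exists_forall_abs_ge_of_unbounded hS ⟨0, h0⟩ _ _
      (fun ξ hξ M => hunb ξ (Finset.ne_of_mem_erase hξ) M) _
  choose z hzS hz using hex
  have hlim (ξ : Fin n → ℤ) (hξ : ξ ≠ 0) :
      Tendsto (fun k => |∑ i, (ξ i : ℝ) * z k i|) atTop atTop := by
    refine tendsto_atTop_mono' _ ?_
      (tendsto_natCast_atTop_atTop.comp (tendsto_snd (α := Finset (Fin n → ℤ)) (β := ℕ)
        (f := atTop) (g := atTop)) |>.mono_left (prod_atTop_atTop_eq).ge)
    filter_upwards [eventually_ge_atTop (({ξ}, 0) : Finset (Fin n → ℤ) × ℕ)] with k hk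
    have := hz k ξ (Finset.mem_erase.2 ⟨hξ, hk.1 (Finset.mem_singleton_self ξ)⟩)
    simpa [PiLp.inner_apply, mul_comm] using this
  set g : UnitAddTorus (Fin n) → ℝ := fun x => max (r - dist x (q θ)) 0 with hg
  have hgc : Continuous g := by fun_prop
  have hgS : ∀ y ∈ S, g (q y) = 0 := fun y hy => max_eq_right (by linarith [hfar y hy])
  set f : C(UnitAddTorus (Fin n), ℂ) := ⟨fun x => (g x : ℂ), by fun_prop⟩ with hf
  have : IsProbabilityMeasure (volume : Measure UnitAddCircle) := ⟨UnitAddCircle.measure_univ⟩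
  have : IsProbabilityMeasure (volume : Measure (UnitAddTorus (Fin n))) :=
    inferInstanceAs (IsProbabilityMeasure (Measure.pi fun _ : Fin n => (volume : Measure UnitAddCircle)))
  have havg := tendsto_segment_average volume (fun k i => z k i) hlim f
  have hzero (k) : ∫ τ in (0 : ℝ)..1, f (fun i => ((τ * z k i : ℝ) : UnitAddCircle)) = 0 := by
    rw [intervalIntegral.integral_congr (g := fun _ => (0 : ℂ)), intervalIntegral.integral_zero]
    intro τ hτ
    rw [uIcc_of_le zero_le_one] at hτ
    have hmem : τ • z k ∈ S := hS.smul_mem_of_zero_mem h0 (hzS k) hτ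
    have := hgS _ hmem
    simp only [hf, ContinuousMap.coe_mk]
    exact_mod_cast this
  simp only [hzero] at havg
  have hint : ∫ x, f x = 0 := tendsto_nhds_unique havg tendsto_const_nhds |>.symm ▸ rfl
  have hpos : 0 < ∫ x, g x :=
    hgc.integral_pos_of_hasCompactSupport_nonneg_nonzero (HasCompactSupport.of_compactSpace _)
      (fun x => le_max_right _ _) (x := q θ) (by simp [hg, hrpos.ne', hrpos.le])
  have : ∫ x, f x = ((∫ x, g x : ℝ) : ℂ) := integral_ofReal
  rw [this] at hint
  exact hpos.ne' (by exact_mod_cast hint)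

/-- If a nonnegative convex function `G` vanishing at `0` is positive on an open ray, the sets
`{z | ⟪z, ·⟫ ≤ η + t * G}` become unbounded in the direction of this ray as `t` grows. -/
lemma exists_inner_eq_of_pos_on_ray [CompleteSpace E] {G : E → ℝ} (hG : ConvexOn ℝ univ G)
    (hGc : Continuous G) (hG0 : G 0 = 0) (hGnn : ∀ p, 0 ≤ G p) {ξ : E}
    (hξ : ∀ s : ℝ, 0 < s → 0 < G (s • ξ)) {η M : ℝ} (hη : 0 < η) (hM : 0 < M) :
    ∃ t ≥ 0, ∃ z : E, (∀ p, ⟪z, p⟫ ≤ η + t * G p) ∧ ⟪z, ξ⟫ = M := by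
  set a : ℝ := η / M with ha
  have hapos : 0 < a := by positivity
  have haM : M * a = η := by rw [ha]; field_simp
  have hGa := hξ a hapos
  set t : ℝ := η / G (a • ξ) with ht
  have ht0 : 0 ≤ t := by positivity
  have htG : t * G (a • ξ) = η := div_mul_cancel₀ _ hGa.ne'
  refine ⟨t, ht0, exists_inner_le_of_line_le (f := fun p => η + t * G p) ?_ (by fun_prop) ξ M ?_⟩
  · exact (convexOn_const η convex_univ).add (hG.smul ht0)
  · intro s
    by_cases hs : s ≤ a
    · have h1 := mul_le_mul_of_nonneg_left hs hM.le
      have h2 := mul_nonneg ht0 (hGnn (s • ξ))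
      linarith
    · have hsa := not_le.1 hs
      have hs0 : 0 < s := hapos.trans hsa
      have h1 : G (a • ξ) ≤ a / s * G (s • ξ) := by
        have := hG.2 (mem_univ (s • ξ)) (mem_univ (0 : E))
          (show 0 ≤ a / s by positivity) (sub_nonneg.2 ((div_le_one hs0).2 hsa.le)) (by ring)
        rwa [smul_zero, add_zero, smul_smul, div_mul_cancel₀ _ hs0.ne', hG0, smul_zero, add_zero,
          smul_eq_mul] at this
      have h2 := mul_le_mul_of_nonneg_left h1 ht0
      rw [htG] at h2
      have h3 : M * s ≤ t * G (s • ξ) := by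
        calc M * s = η * (s / a) := by rw [← haM]; field_simp
          _ ≤ t * (a / s * G (s • ξ)) * (s / a) := by gcongr
          _ = t * G (s • ξ) := by field_simp
      linarith

/-- The sets `{z | ⟪z, ·⟫ ≤ η + t * G}` become uniformly dense modulo `ℤⁿ` if the nonnegative
convex function `G`, vanishing at `0`, does not vanish on a neighbourhood of `0` in any rational
line. -/
lemma exists_time_forall_norm_sub_sub_lt {n : ℕ} {G : EuclideanSpace ℝ (Fin n) → ℝ}
    (hG : ConvexOn ℝ univ G) (hGc : Continuous G) (hG0 : G 0 = 0) (hGnn : ∀ p, 0 ≤ G p)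
    (hND : ∀ ξ : Fin n → ℤ, ξ ≠ 0 → ∀ δ : ℝ, 0 < δ → ∃ s : ℝ, |s| < δ ∧
      G (s • WithLp.toLp 2 (fun i => (ξ i : ℝ))) ≠ 0)
    {η ρ : ℝ} (hη : 0 < η) (hρ : 0 < ρ) :
    ∃ T ≥ 0, ∀ t ≥ T, ∀ θ : EuclideanSpace ℝ (Fin n), ∃ z : EuclideanSpace ℝ (Fin n),
      (∀ p, ⟪z, p⟫ ≤ η + t * G p) ∧
      ∃ e : Fin n → ℤ, ‖θ - z - WithLp.toLp 2 (fun i => (e i : ℝ))‖ < ρ := by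
  set A : ℝ → Set (EuclideanSpace ℝ (Fin n)) := fun t => {z | ∀ p, ⟪z, p⟫ ≤ η + t * G p} with hA
  have hAmono : Monotone A := fun s t hst z hz p =>
    (hz p).trans (by have := mul_le_mul_of_nonneg_right hst (hGnn p); linarith)
  have hAconv (t : ℝ) : Convex ℝ (A t) := by
    intro x hx y hy a b ha hb hab p
    rw [inner_add_left, real_inner_smul_left, real_inner_smul_left]
    calc a * ⟪x, p⟫ + b * ⟪y, p⟫ ≤ a * (η + t * G p) + b * (η + t * G p) := by
          gcongr
          · exact hx p
          · exact hy p
      _ = η + t * G p := by rw [← add_mul, hab, one_mul]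
  set S : Set (EuclideanSpace ℝ (Fin n)) := ⋃ t : Ici (0 : ℝ), A t with hS
  have hSconv : Convex ℝ S :=
    Directed.convex_iUnion (Monotone.directed_le fun s t hst => hAmono hst) fun t => hAconv t
  have h0S : (0 : EuclideanSpace ℝ (Fin n)) ∈ S :=
    mem_iUnion.2 ⟨⟨0, self_mem_Ici⟩, fun p => by simpa using hη.le⟩
  have hvanish (ζ : EuclideanSpace ℝ (Fin n)) (s : ℝ) (hs : 0 < s)
      (hGs : G (s • ζ) ≤ 0) (r : ℝ) (hr0 : 0 ≤ r)
      (hrs : r ≤ s) : G (r • ζ) = 0 := by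
    refine le_antisymm ?_ (hGnn _)
    have := hG.2 (mem_univ (s • ζ)) (mem_univ (0 : EuclideanSpace ℝ (Fin n)))
      (show 0 ≤ r / s by positivity) (sub_nonneg.2 ((div_le_one hs).2 hrs)) (by ring)
    rw [smul_zero, add_zero, smul_smul, div_mul_cancel₀ _ hs.ne', hG0, smul_zero, add_zero,
      smul_eq_mul] at this
    exact this.trans (mul_nonpos_of_nonneg_of_nonpos (by positivity) hGs)
  have hunb (ξ : Fin n → ℤ) (hξ : ξ ≠ 0) (M : ℝ) : ∃ z ∈ S,
      M ≤ |⟪(WithLp.toLp 2 fun i => (ξ i : ℝ) : EuclideanSpace ℝ (Fin n)), z⟫| := by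
    set ζ : EuclideanSpace ℝ (Fin n) := WithLp.toLp 2 fun i => (ξ i : ℝ) with hζ
    have hMpos : 0 < |M| + 1 := by positivity
    have hray (ω : EuclideanSpace ℝ (Fin n)) (hω : ∀ s : ℝ, 0 < s → 0 < G (s • ω)) :
        ∃ z ∈ S, M ≤ |⟪ω, z⟫| := by
      obtain ⟨t, ht, z, hz, hzω⟩ :=
        exists_inner_eq_of_pos_on_ray hG hGc hG0 hGnn hω hη hMpos
      refine ⟨z, mem_iUnion.2 ⟨⟨t, ht⟩, hz⟩, ?_⟩
      rw [real_inner_comm, hzω, abs_of_pos hMpos]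
      linarith [le_abs_self M]
    by_cases h1 : ∀ s : ℝ, 0 < s → 0 < G (s • ζ)
    · exact hray ζ h1
    by_cases h2 : ∀ s : ℝ, 0 < s → 0 < G (s • -ζ)
    · obtain ⟨z, hz, hzM⟩ := hray (-ζ) h2
      exact ⟨z, hz, by simpa [inner_neg_left] using hzM⟩
    push Not at h1 h2
    obtain ⟨s₁, hs₁, hG₁⟩ := h1
    obtain ⟨s₂, hs₂, hG₂⟩ := h2
    obtain ⟨s, hs, hne⟩ := hND ξ hξ (min s₁ s₂) (lt_min hs₁ hs₂)
    refine absurd ?_ hne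
    rcases le_total 0 s with h | h
    · rw [abs_of_nonneg h] at hs
      exact hvanish ζ s₁ hs₁ hG₁ s h (hs.le.trans (min_le_left _ _))
    · rw [abs_of_nonpos h] at hs
      have := hvanish (-ζ) s₂ hs₂ hG₂ (-s) (by linarith) (hs.le.trans (min_le_right _ _))
      rwa [smul_neg, neg_smul, neg_neg] at this
  set U : Ici (0 : ℝ) → Set (EuclideanSpace ℝ (Fin n)) := fun t => {θ | ∃ z ∈ A t, ∃ e : Fin n → ℤ,
    ‖θ - z - WithLp.toLp 2 (fun i => (e i : ℝ))‖ < ρ} with hU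
  have hUopen (t : Ici (0 : ℝ)) : IsOpen (U t) := by
    have : U t = ⋃ z ∈ A t, ⋃ e : Fin n → ℤ,
        {θ | ‖θ - z - WithLp.toLp 2 (fun i => (e i : ℝ))‖ < ρ} := by
      ext θ
      simp [hU]
    rw [this]
    exact isOpen_biUnion fun z _ => isOpen_iUnion fun e =>
      isOpen_lt (by fun_prop) continuous_const
  have hUmono : Monotone U := fun s t hst θ ⟨z, hz, he⟩ => ⟨z, hAmono hst hz, he⟩
  have hcover : Metric.closedBall (0 : EuclideanSpace ℝ (Fin n)) √n ⊆ ⋃ t, U t := by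
    intro θ _
    obtain ⟨z, hz, e, he⟩ := exists_norm_sub_sub_lt_of_unbounded hSconv h0S hunb θ hρ
    obtain ⟨t, ht⟩ := mem_iUnion.1 hz
    exact mem_iUnion.2 ⟨t, z, ht, e, he⟩
  obtain ⟨T, hT⟩ := (isCompact_closedBall (0 : EuclideanSpace ℝ (Fin n)) √n).elim_directed_cover
    U hUopen hcover hUmono.directed_le
  refine ⟨T, T.2, fun t ht θ => ?_⟩
  set f : EuclideanSpace ℝ (Fin n) := WithLp.toLp 2 fun i => ((⌊θ i⌋ : ℤ) : ℝ) with hf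
  have hmem : θ - f ∈ Metric.closedBall (0 : EuclideanSpace ℝ (Fin n)) √n := by
    rw [mem_closedBall_zero_iff, EuclideanSpace.norm_eq]
    refine Real.sqrt_le_sqrt ?_
    calc ∑ i, ‖(θ - f) i‖ ^ 2 ≤ ∑ _i : Fin n, (1 : ℝ) := by
          refine Finset.sum_le_sum fun i _ => ?_
          have h1 : (θ - f) i = Int.fract (θ i) := rfl
          rw [h1, Real.norm_of_nonneg (Int.fract_nonneg _)]
          exact pow_le_one₀ (Int.fract_nonneg _) (Int.fract_lt_one _).le
      _ = n := by simp
  obtain ⟨z, hz, e, he⟩ := hT hmem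
  refine ⟨z, hAmono ht hz, fun i => ⌊θ i⌋ + e i, ?_⟩
  convert he using 2
  ext i
  change θ i - z i - ((⌊θ i⌋ + e i : ℤ) : ℝ) = θ i - (⌊θ i⌋ : ℝ) - z i - (e i : ℝ)
  push_cast
  ring

/-- **Periodic case with coercive hamiltonian** (Theorem 2): if `H` is convex, `H(0) = 0`,
coercive (`H(v)/|v| → +∞`), and for every nonzero `ξ ∈ ℤⁿ` the map `s ↦ H(sξ)` is not affine
near `0`, then the viscosity solution with continuous `ℤⁿ`-periodic datum `u₀` decays
uniformly to `c = min u₀`. -/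
theorem decay_periodic_coercive {n : ℕ} (H : EuclideanSpace ℝ (Fin n) → ℝ) (hH : Continuous H)
    (hconv : ConvexOn ℝ Set.univ H) (hH0 : H 0 = 0)
    (hcoerc : Tendsto (fun v : EuclideanSpace ℝ (Fin n) => H v / ‖v‖)
      (Filter.cocompact _) Filter.atTop)
    (hND : ∀ ξ : EuclideanSpace ℝ (Fin n), (∀ i, ∃ k : ℤ, ξ i = (k : ℝ)) → ξ ≠ 0 →
      ∀ δ : ℝ, 0 < δ → ¬ ∃ α β : ℝ, ∀ s : ℝ, |s| < δ → H (s • ξ) = α * s + β)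
    (u₀ : EuclideanSpace ℝ (Fin n) → ℝ) (h₀cont : Continuous u₀)
    (h₀per : ∀ x : EuclideanSpace ℝ (Fin n), ∀ e : Fin n → ℤ,
      u₀ (x + (EuclideanSpace.equiv (Fin n) ℝ).symm (fun i => (e i : ℝ))) = u₀ x)
    (u : ℝ × EuclideanSpace ℝ (Fin n) → ℝ) (hu : IsViscSol H u₀ u) :
    ∀ ε : ℝ, 0 < ε → ∃ T : ℝ, ∀ t ≥ T, ∀ x : EuclideanSpace ℝ (Fin n),
      |u (t, x) - sInf (Set.range u₀)| ≤ ε := by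
  intro ε hε
  obtain ⟨⟨hu, hu0le, hsub⟩, -, hu0ge, hsup⟩ := hu
  have hu0 (x : EuclideanSpace ℝ (Fin n)) : u (0, x) = u₀ x := le_antisymm (hu0le x) (hu0ge x)
  obtain ⟨B, -, hB⟩ := hu.exists_bound 0
  have hbdd : BddBelow (range u₀) := by
    refine ⟨-B, ?_⟩
    rintro _ ⟨x, rfl⟩
    rw [← hu0]
    exact (abs_le.1 (hB 0 ⟨le_rfl, le_rfl⟩ x)).1
  set m := sInf (range u₀) with hm
  obtain ⟨_, ⟨y, rfl⟩, hy⟩ := exists_lt_of_csInf_lt (range_nonempty u₀)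
    (show sInf (range u₀) < m + ε / 3 by linarith)
  obtain ⟨ρ, hρ, hcont⟩ : ∃ ρ > 0, ∀ x, ‖x - y‖ < ρ → u₀ x < u₀ y + ε / 3 := by
    obtain ⟨ρ, hρ, h⟩ := Metric.continuous_iff.1 h₀cont y (ε / 3) (by positivity)
    refine ⟨ρ, hρ, fun x hx => ?_⟩
    have := h x (by rwa [dist_eq_norm])
    rw [Real.dist_eq] at this
    linarith [(abs_lt.1 this).2]
  obtain ⟨w, hw, -⟩ := exists_inner_le_of_line_le hconv hH 0 0 (fun s => by simp [hH0])
  set G : EuclideanSpace ℝ (Fin n) → ℝ := fun p => H p - ⟪w, p⟫ with hGdef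
  have hGconv : ConvexOn ℝ univ G := hconv.sub ((innerₛₗ ℝ w).concaveOn convex_univ)
  have hGc : Continuous G := by fun_prop
  have hGnn (p : EuclideanSpace ℝ (Fin n)) : 0 ≤ G p := sub_nonneg.2 (hw p)
  have hGND (ξ : Fin n → ℤ) (hξ : ξ ≠ 0) (δ : ℝ) (hδ : 0 < δ) : ∃ s : ℝ, |s| < δ ∧
      G (s • WithLp.toLp 2 (fun i => (ξ i : ℝ))) ≠ 0 := by
    by_contra! hcon
    refine hND (WithLp.toLp 2 fun i => (ξ i : ℝ)) (fun i => ⟨ξ i, rfl⟩) (fun h => hξ ?_) δ hδ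
      ⟨⟪w, WithLp.toLp 2 fun i => (ξ i : ℝ)⟫, 0, fun s hs => ?_⟩
    · ext i
      have : (ξ i : ℝ) = 0 := congrArg (fun v : EuclideanSpace ℝ (Fin n) => v i) h
      exact_mod_cast this
    · have := sub_eq_zero.1 (hcon s hs)
      rw [this, real_inner_smul_right]
      ring
  obtain ⟨T, hT, hdense⟩ := exists_time_forall_norm_sub_sub_lt hGconv hGc (by simp [hGdef, hH0])
    hGnn hGND (η := ε / 3) (by positivity) hρ
  refine ⟨T + 1, fun t ht x => ?_⟩
  have htpos : 0 < t := by linarith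
  have hlow : m ≤ u (t, x) := le_of_supersol hH hH0 hu hsup
    (fun x => (hu0 x).symm ▸ csInf_le hbdd (mem_range_self x)) htpos.le x
  obtain ⟨z, hz, e, he⟩ := hdense t (by linarith) (x - t • w - y)
  have hup := le_add_mul_of_subsol hu hsub (w := w + t⁻¹ • z) (ℓ := ε / 3 / t) (fun p => by
    have h1 := mul_le_mul_of_nonneg_left (hz p) (inv_nonneg.2 htpos.le)
    have h2 : t⁻¹ * (ε / 3 + t * G p) = ε / 3 / t + G p := by field_simp
    rw [h2] at h1
    rw [inner_add_left, real_inner_smul_left]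
    simp only [hGdef] at h1
    linarith) htpos.le (x - t • w - z)
  have hx : x - t • w - z + t • (w + t⁻¹ • z) = x := by
    rw [smul_add, smul_inv_smul₀ htpos.ne']
    abel
  rw [hx, div_mul_cancel₀ _ htpos.ne', hu0] at hup
  set k : EuclideanSpace ℝ (Fin n) := WithLp.toLp 2 fun i => (e i : ℝ) with hk
  have hper : u₀ (x - t • w - z) = u₀ (x - t • w - z - k) := by
    have := h₀per (x - t • w - z - k) e
    rw [← this]
    congr 1
    exact (sub_add_cancel _ k).symm
  have hval := hcont (x - t • w - z - k) (by convert he using 2; abel)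
  rw [abs_le]
  constructor <;> linarith
end
end

section
/- Propagation of the Lipschitz property: Let H∈C(ℝⁿ) and let u ∈ BUC_loc(Π̄) be a viscosity solution of u_t+H(∇_x u)=0 with initial data u₀ ∈ BUC(ℝⁿ) satisfying |u₀(x)−u₀(y)| ≤ L|x−y| for all x,y∈ℝⁿ, where L>0. Then for every t>0 and all x,h∈ℝⁿ, |u(t,x+h)−u(t,x)| ≤ L|h|, i.e. u(t,·) is Lipschitz with the same constant L. -/
open Set Filter Topology RealInnerProductSpace MeasureTheory

noncomputable section

variable {E : Type*} [NormedAddCommGroup E] [InnerProductSpace ℝ E]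

/-- The one-point test function used in the doubling of variables. -/
def doublingTest (α β η k τ s : ℝ) (z : E) (q : ℝ × E) : ℝ :=
  α * (q.1 - s) ^ 2 + α * ‖q.2 - z‖ ^ 2 + β * ‖q.2‖ ^ 2 + η * Real.exp (k * (q.1 - τ))

lemma contDiff_doublingTest (α β η k τ s : ℝ) (z : E) :
    ContDiff ℝ 1 (doublingTest α β η k τ s z) := by
  unfold doublingTest
  have h₁ : ContDiff ℝ 1 fun q : ℝ × E => ‖q.2 - z‖ ^ 2 :=
    (contDiff_snd.sub contDiff_const).norm_sq ℝ
  have h₂ : ContDiff ℝ 1 fun q : ℝ × E => ‖q.2‖ ^ 2 := contDiff_snd.norm_sq ℝ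
  fun_prop

lemma fderiv_doublingTest_time (α β η k τ s : ℝ) (z : E) (p : ℝ × E) :
    fderiv ℝ (doublingTest α β η k τ s z) p (1, 0) =
      2 * α * (p.1 - s) + η * k * Real.exp (k * (p.1 - τ)) := by
  have hd := ((contDiff_doublingTest α β η k τ s z).differentiable one_ne_zero) p
  have hc : HasDerivAt (fun r : ℝ => (r, p.2)) (1, (0 : E)) p.1 :=
    (hasDerivAt_id p.1).prodMk (hasDerivAt_const _ _)
  have hl := hd.hasFDerivAt.comp_hasDerivAt p.1 hc
  have h₁ : HasDerivAt (fun r : ℝ => α * (r - s) ^ 2) (α * (2 * (p.1 - s))) p.1 := by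
    simpa using (((hasDerivAt_id p.1).sub_const s).pow 2).const_mul α
  have h₂ : HasDerivAt (fun r : ℝ => η * Real.exp (k * (r - τ)))
      (η * (Real.exp (k * (p.1 - τ)) * k)) p.1 := by
    simpa using ((((hasDerivAt_id p.1).sub_const τ).const_mul k).exp).const_mul η
  have hr := ((h₁.add_const (α * ‖p.2 - z‖ ^ 2)).add_const (β * ‖p.2‖ ^ 2)).add h₂
  exact (hl.unique hr).trans (by ring)

lemma fderiv_doublingTest_space (α β η k τ s : ℝ) (z : E) (p : ℝ × E) (w : E) :
    fderiv ℝ (doublingTest α β η k τ s z) p (0, w) =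
      ⟪(2 * α) • (p.2 - z) + (2 * β) • p.2, w⟫ := by
  have hd := ((contDiff_doublingTest α β η k τ s z).differentiable one_ne_zero) p
  have hc : HasFDerivAt (fun x : E => (p.1, x)) (ContinuousLinearMap.inr ℝ ℝ E) p.2 :=
    hasFDerivAt_prodMk_right p.1 p.2
  have hl := hd.hasFDerivAt.comp p.2 hc
  have h₁ := ((hasFDerivAt_id p.2).sub_const z).norm_sq.const_mul α
  have h₂ := (hasFDerivAt_id p.2).norm_sq.const_mul β
  have hr := ((h₁.const_add (α * (p.1 - s) ^ 2)).add h₂).add_const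
    (η * Real.exp (k * (p.1 - τ)))
  have := DFunLike.congr_fun (hl.unique hr) w
  simp only [ContinuousLinearMap.comp_apply, ContinuousLinearMap.inr_apply] at this
  rw [this]
  simp [inner_add_left, inner_smul_left, inner_sub_left]
  ring

lemma IsViscSubsol.doublingTest_le {H u₀ : E → ℝ} {u : ℝ × E → ℝ} (hu : IsViscSubsol H u₀ u)
    {α β η k τ s : ℝ} {z : E} {p : ℝ × E} (hp : 0 < p.1)
    (hmax : IsLocalMaxOn (fun q => u q - doublingTest α β η k τ s z q) (PiDom E) p) :
    2 * α * (p.1 - s) + η * k * Real.exp (k * (p.1 - τ)) +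
      H ((2 * α) • (p.2 - z) + (2 * β) • p.2) ≤ 0 :=
  hu.2.2 p ⟨hp, mem_univ _⟩ (_, _) ⟨_, contDiff_doublingTest α β η k τ s z, hmax,
    fderiv_doublingTest_time .., fun _ => fderiv_doublingTest_space ..⟩

lemma IsViscSupersol.le_doublingTest {H u₀ : E → ℝ} {v : ℝ × E → ℝ}
    (hv : IsViscSupersol H u₀ v) {α β η k τ s : ℝ} {z : E} {p : ℝ × E} (hp : 0 < p.1)
    (hmin : IsLocalMinOn (fun q => v q + doublingTest α β η k τ s z q) (PiDom E) p) :
    0 ≤ -(2 * α * (p.1 - s) + η * k * Real.exp (k * (p.1 - τ))) +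
      H (-((2 * α) • (p.2 - z) + (2 * β) • p.2)) := by
  refine hv.2.2 p ⟨hp, mem_univ _⟩ (_, _)
    ⟨fun q => -doublingTest α β η k τ s z q, (contDiff_doublingTest α β η k τ s z).neg, ?_, ?_, ?_⟩
  · simpa only [sub_neg_eq_add] using hmin
  · rw [fderiv_fun_neg, neg_apply, fderiv_doublingTest_time]
  · intro w
    rw [fderiv_fun_neg, neg_apply, fderiv_doublingTest_space, inner_neg_left]

omit [InnerProductSpace ℝ E] in
/-- A uniform modulus of continuity at the points of a ball. -/
lemma Continuous.exists_forall_closedBall_abs_sub_lt [ProperSpace E] {H : E → ℝ}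
    (hH : Continuous H) (P : ℝ) {ε : ℝ} (hε : 0 < ε) :
    ∃ ρ > 0, ∀ p q : E, ‖p‖ ≤ P → ‖q‖ < ρ → |H (p + q) - H p| < ε := by
  have huc := (isCompact_closedBall (0 : E) (P + 1)).uniformContinuousOn_of_continuous
    hH.continuousOn
  obtain ⟨ρ, hρ, h⟩ := Metric.uniformContinuousOn_iff.1 huc ε hε
  refine ⟨min ρ 1, lt_min hρ one_pos, fun p q hp hq => ?_⟩
  have hq₁ := lt_of_lt_of_le hq (min_le_left _ _)
  have hq₂ := lt_of_lt_of_le hq (min_le_right _ _)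
  rw [← Real.dist_eq]
  refine h _ ?_ _ ?_ ?_
  · rw [mem_closedBall_zero_iff]
    linarith [norm_add_le p q]
  · rw [mem_closedBall_zero_iff]
    linarith
  · simpa [dist_eq_norm] using hq₁

omit [InnerProductSpace ℝ E] in
lemma IsBUCloc.exists_forall_abs_sub_lt {u : ℝ × E → ℝ} (hu : IsBUCloc u) {T : ℝ} (hT : 0 < T)
    {ε : ℝ} (hε : 0 < ε) :
    ∃ δ > 0, ∀ t ∈ Ico 0 T, ∀ s ∈ Ico 0 T, ∀ x y : E, |t - s| < δ → ‖x - y‖ < δ →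
      |u (t, x) - u (s, y)| < ε := by
  obtain ⟨δ, hδ, h⟩ := Metric.uniformContinuousOn_iff.1 (hu.2 T hT).2 ε hε
  refine ⟨δ, hδ, fun t ht s hs x y hts hxy => ?_⟩
  rw [← Real.dist_eq]
  refine h _ ⟨ht, mem_univ _⟩ _ ⟨hs, mem_univ _⟩ ?_
  rw [Prod.dist_eq, Real.dist_eq, dist_eq_norm]
  exact max_lt hts hxy

/-- The doubled functional, with the second space variable translated by `h`. -/
def doubling (u v : ℝ × E → ℝ) (h : E) (α β η k τ : ℝ) (q : (ℝ × E) × (ℝ × E)) : ℝ :=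
  u q.1 - v q.2 - (α * (q.1.1 - q.2.1) ^ 2 + α * ‖q.1.2 - q.2.2 - h‖ ^ 2 + β * ‖q.1.2‖ ^ 2 +
    η * Real.exp (k * (q.1.1 - τ)) + η * Real.exp (k * (q.2.1 - τ)))

omit [InnerProductSpace ℝ E] in
lemma exists_isMaxOn_doubling [ProperSpace E] {u v : ℝ × E → ℝ} {T M α β η : ℝ}
    (hu : ContinuousOn u (Icc 0 T ×ˢ univ)) (hv : ContinuousOn v (Icc 0 T ×ˢ univ))
    (hMu : ∀ p ∈ Icc 0 T ×ˢ (univ : Set E), |u p| ≤ M)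
    (hMv : ∀ p ∈ Icc 0 T ×ˢ (univ : Set E), |v p| ≤ M)
    (hT : 0 ≤ T) (hα : 0 < α) (hβ : 0 < β) (hη : 0 ≤ η) (h : E) (k τ : ℝ) :
    ∃ q ∈ (Icc 0 T ×ˢ univ) ×ˢ (Icc 0 T ×ˢ (univ : Set E)),
      IsMaxOn (doubling u v h α β η k τ) ((Icc 0 T ×ˢ univ) ×ˢ (Icc 0 T ×ˢ univ)) q := by
  set S : Set ((ℝ × E) × (ℝ × E)) := (Icc 0 T ×ˢ univ) ×ˢ (Icc 0 T ×ˢ univ) with hS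
  have hcont : ContinuousOn (doubling u v h α β η k τ) S := by
    have h₁ : ContinuousOn (fun q : (ℝ × E) × (ℝ × E) => u q.1) S :=
      hu.comp continuousOn_fst fun q hq => hq.1
    have h₂ : ContinuousOn (fun q : (ℝ × E) × (ℝ × E) => v q.2) S :=
      hv.comp continuousOn_snd fun q hq => hq.2
    unfold doubling
    refine (h₁.sub h₂).sub (Continuous.continuousOn ?_)
    fun_prop
  have hclosed : IsClosed S :=
    (isClosed_Icc.prod isClosed_univ).prod (isClosed_Icc.prod isClosed_univ)
  have h0 : (((0 : ℝ), (0 : E)), ((0 : ℝ), (0 : E))) ∈ S := by simp [hS, hT]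
  set m := doubling u v h α β η k τ (((0 : ℝ), (0 : E)), ((0 : ℝ), (0 : E))) with hm
  set C := |2 * M - m| with hC
  set R := 1 + C / β with hR
  set R' := R + ‖h‖ + (1 + C / α) with hR'
  have hK : IsCompact ((Icc 0 T ×ˢ Metric.closedBall (0 : E) R) ×ˢ
      (Icc 0 T ×ˢ Metric.closedBall (0 : E) R')) :=
    (isCompact_Icc.prod (isCompact_closedBall _ _)).prod
      (isCompact_Icc.prod (isCompact_closedBall _ _))
  refine hcont.exists_isMaxOn' hclosed h0 ?_
  rw [eventually_inf_principal]
  filter_upwards [hK.compl_mem_cocompact] with q hq hqS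
  by_contra! hlt
  apply hq
  obtain ⟨⟨t, x⟩, ⟨s, y⟩⟩ := q
  have hut := abs_le.1 (hMu _ hqS.1)
  have hvs := abs_le.1 (hMv _ hqS.2)
  have hCm : 2 * M - m ≤ C := le_abs_self _
  rw [← hm] at hlt
  simp only [doubling] at hlt
  have e₁ : 0 ≤ η * Real.exp (k * (t - τ)) := by positivity
  have e₂ : 0 ≤ η * Real.exp (k * (s - τ)) := by positivity
  have e₃ : 0 ≤ α * (t - s) ^ 2 := by positivity
  have e₄ : 0 ≤ α * ‖x - y - h‖ ^ 2 := by positivity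
  have e₅ : 0 ≤ β * ‖x‖ ^ 2 := by positivity
  have aux : ∀ a r : ℝ, 0 < a → a * r ^ 2 ≤ C → r ≤ 1 + C / a := by
    intro a r ha har
    have : r ^ 2 ≤ C / a := by rw [le_div_iff₀ ha]; linarith
    nlinarith [sq_nonneg (r - 1)]
  have hx : ‖x‖ ≤ R := aux β _ hβ (by linarith)
  have hxy : ‖x - y - h‖ ≤ 1 + C / α := aux α _ hα (by linarith)
  refine ⟨⟨hqS.1.1, by simpa using hx⟩, ⟨hqS.2.1, ?_⟩⟩
  rw [mem_closedBall_zero_iff]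
  have : y = x - h - (x - y - h) := by abel
  calc ‖y‖ = ‖x - h - (x - y - h)‖ := by rw [← this]
    _ ≤ ‖x‖ + ‖h‖ + ‖x - y - h‖ := (norm_sub_le _ _).trans (by gcongr; exact norm_sub_le _ _)
    _ ≤ R' := by rw [hR']; gcongr

/-- Comparison principle with a translation in space. -/
theorem IsViscSubsol.sub_le_of_initial [ProperSpace E] {H u₀ v₀ : E → ℝ} (hH : Continuous H)
    {u v : ℝ × E → ℝ} (hu : IsViscSubsol H u₀ u) (hv : IsViscSupersol H v₀ v) {h : E} {c : ℝ}
    (hc : ∀ x, u (0, x + h) - v (0, x) ≤ c) {t₀ : ℝ} (ht₀ : 0 < t₀) (x₀ : E) :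
    u (t₀, x₀ + h) - v (t₀, x₀) ≤ c := by
  by_contra! hgap
  obtain ⟨σ, hσ, hσgap⟩ : ∃ σ > 0, c + 4 * σ ≤ u (t₀, x₀ + h) - v (t₀, x₀) :=
    ⟨(u (t₀, x₀ + h) - v (t₀, x₀) - c) / 4, by linarith, by linarith⟩
  set T := 2 * t₀ with hT
  have hT3 : 0 < 3 * t₀ := by positivity
  have hsub : Icc 0 T ⊆ Ico 0 (3 * t₀) := fun r hr => ⟨hr.1, by linarith [hr.2]⟩
  have hsub' : Icc 0 T ×ˢ (univ : Set E) ⊆ Ici 0 ×ˢ univ := fun p hp => ⟨hp.1.1, hp.2⟩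
  obtain ⟨M, hMu, hMv⟩ : ∃ M, (∀ p ∈ Icc 0 T ×ˢ (univ : Set E), |u p| ≤ M) ∧
      ∀ p ∈ Icc 0 T ×ˢ (univ : Set E), |v p| ≤ M := by
    obtain ⟨M₁, h₁⟩ := (hu.1.2 _ hT3).1
    obtain ⟨M₂, h₂⟩ := (hv.1.2 _ hT3).1
    exact ⟨max M₁ M₂, fun p hp => (h₁ p ⟨hsub hp.1, hp.2⟩).trans (le_max_left _ _),
      fun p hp => (h₂ p ⟨hsub hp.1, hp.2⟩).trans (le_max_right _ _)⟩
  have ht₀mem : t₀ ∈ Icc 0 T := ⟨ht₀.le, by linarith⟩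
  set C := 2 * M + |c| with hC
  have hC0 : 0 ≤ C := by
    have := (abs_nonneg _).trans (hMu (t₀, x₀) ⟨ht₀mem, mem_univ _⟩)
    positivity
  set η := σ / 2 with hη
  have hη0 : 0 < η := by positivity
  obtain ⟨k, hk, hkC⟩ : ∃ k > 0, C < η * Real.exp (k * t₀) := by
    refine ⟨(C + 1) / (η * t₀), by positivity, ?_⟩
    have h₁ : (C + 1) / (η * t₀) * t₀ = (C + 1) / η := by field_simp
    rw [h₁]
    have h₂ := Real.add_one_le_exp ((C + 1) / η)
    have h₃ : η * ((C + 1) / η) = C + 1 := by field_simp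
    nlinarith
  set θ := η * k * Real.exp (k * (0 - t₀)) with hθ
  have hθ0 : 0 < θ := by positivity
  obtain ⟨δ₁, hδ₁, hucu⟩ := hu.1.exists_forall_abs_sub_lt hT3 hσ
  obtain ⟨δ₂, hδ₂, hucv⟩ := hv.1.exists_forall_abs_sub_lt hT3 hσ
  set δ := min δ₁ δ₂ with hδ
  have hδ0 : 0 < δ := lt_min hδ₁ hδ₂
  obtain ⟨α, hα, hαC⟩ : ∃ α > 0, C < α * δ ^ 2 :=
    ⟨(C + 1) / δ ^ 2, by positivity, by rw [div_mul_cancel₀ _ (by positivity)]; linarith⟩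
  obtain ⟨ρ, hρ, hHρ⟩ := hH.exists_forall_closedBall_abs_sub_lt (2 * α * δ)
    (show 0 < 2 * θ by positivity)
  obtain ⟨β, hβ, hβx, hβρ⟩ : ∃ β > 0, β * ‖x₀ + h‖ ^ 2 ≤ σ ∧ 4 * β * C < ρ ^ 2 := by
    have l₁ : Tendsto (fun b : ℝ => b * ‖x₀ + h‖ ^ 2) (𝓝[>] 0) (𝓝 0) :=
      tendsto_nhdsWithin_of_tendsto_nhds (Continuous.tendsto' (by fun_prop) _ _ (by simp))
    have l₂ : Tendsto (fun b : ℝ => 4 * b * C) (𝓝[>] 0) (𝓝 0) :=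
      tendsto_nhdsWithin_of_tendsto_nhds (Continuous.tendsto' (by fun_prop) _ _ (by simp))
    obtain ⟨b, h₁, h₂, h₃⟩ := ((l₁.eventually (eventually_le_nhds hσ)).and
      ((l₂.eventually (eventually_lt_nhds (show 0 < ρ ^ 2 by positivity))).and
        self_mem_nhdsWithin)).exists
    exact ⟨b, h₃, h₁, h₂⟩
  obtain ⟨⟨⟨t, x⟩, ⟨s, y⟩⟩, ⟨⟨ht, -⟩, ⟨hs, -⟩⟩, hmax⟩ := exists_isMaxOn_doubling
    (hu.1.1.mono hsub') (hv.1.1.mono hsub') hMu hMv (show 0 ≤ T by positivity) hα hβ hη0.le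
    h k t₀
  simp only at ht hs
  have hut := abs_le.1 (hMu (t, x) ⟨ht, mem_univ _⟩)
  have hvs := abs_le.1 (hMv (s, y) ⟨hs, mem_univ _⟩)
  have hval : c + 2 * σ ≤ doubling u v h α β η k t₀ ((t, x), (s, y)) := by
    refine le_trans ?_ (hmax (show ((t₀, x₀ + h), (t₀, x₀)) ∈ _ from
      ⟨⟨ht₀mem, mem_univ _⟩, ⟨ht₀mem, mem_univ _⟩⟩))
    simp only [doubling, sub_self, add_sub_cancel_left, mul_zero, Real.exp_zero, norm_zero]
    linarith
  simp only [doubling] at hval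
  have hca := neg_abs_le c
  have e₁ : 0 < η * Real.exp (k * (t - t₀)) := by positivity
  have e₂ : 0 < η * Real.exp (k * (s - t₀)) := by positivity
  have e₃ : 0 ≤ α * (t - s) ^ 2 := by positivity
  have e₄ : 0 ≤ α * ‖x - y - h‖ ^ 2 := by positivity
  have e₅ : 0 ≤ β * ‖x‖ ^ 2 := by positivity
  have htT : t < T := by
    by_contra! hle
    have : t - t₀ = t₀ := by linarith [ht.2]
    rw [this] at hval
    linarith
  have hsT : s < T := by
    by_contra! hle
    have : s - t₀ = t₀ := by linarith [hs.2]
    rw [this] at hval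
    linarith
  have hts : |t - s| < δ := abs_lt_of_sq_lt_sq (lt_of_mul_lt_mul_left (by linarith) hα.le) hδ0.le
  have hxy : ‖x - y - h‖ < δ :=
    lt_of_pow_lt_pow_left₀ 2 hδ0.le (lt_of_mul_lt_mul_left (by linarith) hα.le)
  have hmem0 : (0 : ℝ) ∈ Ico 0 (3 * t₀) := ⟨le_rfl, hT3⟩
  have ht0 : 0 < t := by
    refine lt_of_le_of_ne ht.1 fun h0 => ?_
    subst h0
    have h₁ := hc (x - h)
    rw [sub_add_cancel] at h₁
    have h₂ := hucv 0 hmem0 s (hsub hs) (x - h) y (hts.trans_le (min_le_right _ _))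
      (by rw [sub_right_comm]; exact hxy.trans_le (min_le_right _ _))
    linarith [(abs_lt.1 h₂).2]
  have hs0 : 0 < s := by
    refine lt_of_le_of_ne hs.1 fun h0 => ?_
    subst h0
    have h₁ := hc y
    have h₂ := hucu t (hsub ht) 0 hmem0 x (y + h) (hts.trans_le (min_le_left _ _))
      (by rw [← sub_sub]; exact hxy.trans_le (min_le_left _ _))
    linarith [(abs_lt.1 h₂).2]
  have hlt : ∀ r < T, ∀ z : E, ∀ᶠ q : ℝ × E in 𝓝[PiDom E] (r, z), q.1 ∈ Icc 0 T := by
    intro r hr z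
    have h₁ : ∀ᶠ q : ℝ × E in 𝓝 (r, z), q.1 < T :=
      continuous_fst.continuousAt.eventually (eventually_lt_nhds hr)
    filter_upwards [self_mem_nhdsWithin, mem_nhdsWithin_of_mem_nhds h₁] with q hq hqT
    exact ⟨(show 0 < q.1 from hq.1).le, hqT.le⟩
  have hsubeq := hu.doublingTest_le (α := α) (β := β) (η := η) (k := k) (τ := t₀) (s := s)
    (z := y + h) (p := (t, x)) ht0 (by
      filter_upwards [hlt t htT x] with q hq
      have := hmax (show (q, (s, y)) ∈ _ from ⟨⟨hq, mem_univ _⟩, ⟨hs, mem_univ _⟩⟩)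
      simp only [mem_ofPred_eq, doubling, doublingTest, ← sub_sub] at this ⊢
      linarith)
  have hsupeq := hv.le_doublingTest (α := α) (β := 0) (η := η) (k := k) (τ := t₀) (s := t)
    (z := x - h) (p := (s, y)) hs0 (by
      filter_upwards [hlt s hsT y] with q hq
      have := hmax (show ((t, x), q) ∈ _ from ⟨⟨ht, mem_univ _⟩, ⟨hq, mem_univ _⟩⟩)
      have hn : ∀ w : E, ‖w - (x - h)‖ = ‖x - w - h‖ := fun w => by
        rw [norm_sub_rev, sub_right_comm]
      simp only [mem_ofPred_eq, doubling, doublingTest, hn, sub_sq_comm _ t] at this ⊢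
      linarith)
  simp only at hsubeq hsupeq
  have hgrad : -((2 * α) • (y - (x - h)) + (2 * (0 : ℝ)) • y) = (2 * α) • (x - y - h) := by
    rw [mul_zero, zero_smul, add_zero, ← smul_neg]
    congr 1
    abel
  rw [hgrad] at hsupeq
  rw [← sub_sub] at hsubeq
  have hp : ‖(2 * α) • (x - y - h)‖ ≤ 2 * α * δ := by
    rw [norm_smul, Real.norm_of_nonneg (by positivity)]
    gcongr
  have hq : ‖(2 * β) • x‖ < ρ := by
    refine lt_of_pow_lt_pow_left₀ 2 hρ.le ?_
    rw [norm_smul, Real.norm_of_nonneg (by positivity)]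
    have : β * ‖x‖ ^ 2 ≤ C := by linarith
    calc (2 * β * ‖x‖) ^ 2 = 4 * β * (β * ‖x‖ ^ 2) := by ring
      _ ≤ 4 * β * C := by gcongr
      _ < ρ ^ 2 := hβρ
  have hθt : θ ≤ η * k * Real.exp (k * (t - t₀)) := by rw [hθ]; gcongr
  have hθs : θ ≤ η * k * Real.exp (k * (s - t₀)) := by rw [hθ]; gcongr
  linarith [(abs_lt.1 (hHρ _ _ hp hq)).1]

/-- **Propagation of the Lipschitz property**: if the initial datum is `L`-Lipschitz then so is
`u(t,·)` for every `t > 0`. -/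
theorem lipschitz_propagation {n : ℕ} (H : EuclideanSpace ℝ (Fin n) → ℝ) (hH : Continuous H)
    (u₀ : EuclideanSpace ℝ (Fin n) → ℝ) (h₀ : IsBUC u₀) (L : ℝ) (hL : 0 < L)
    (hLip : ∀ x y : EuclideanSpace ℝ (Fin n), |u₀ x - u₀ y| ≤ L * ‖x - y‖)
    (u : ℝ × EuclideanSpace ℝ (Fin n) → ℝ) (hu : IsViscSol H u₀ u) :
    ∀ t : ℝ, 0 < t → ∀ x h : EuclideanSpace ℝ (Fin n),
      |u (t, x + h) - u (t, x)| ≤ L * ‖h‖ := by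
  intro t ht x h
  have key : ∀ x h : EuclideanSpace ℝ (Fin n), u (t, x + h) - u (t, x) ≤ L * ‖h‖ := by
    refine fun x h => hu.1.sub_le_of_initial hH hu.2 (fun y => ?_) ht x
    have h₁ := (abs_le.1 (hLip (y + h) y)).2
    rw [add_sub_cancel_left] at h₁
    linarith [hu.1.2.1 (y + h), hu.2.2.1 y]
  have h₂ := key (x + h) (-h)
  rw [add_neg_cancel_right, norm_neg] at h₂
  exact abs_le.2 ⟨by linarith, key x h⟩
end
end

section
/- Let H:ℝⁿ→ℝ be convex with H(0)=0 and coercive (H(v)/|v| → +∞ as |v|→∞), and assume that for every nonzero ξ∈ℤⁿ the function s↦H(sξ) is not affine on any interval (−δ,δ), δ>0. Let H*(p)=sup_v(p·v−H(v)), let p₀∈ℝⁿ satisfy H*(p₀)=0, and for ε>0 set G = {p∈ℝⁿ : p·v ≤ ε for all v∈∂H*(p₀)}, where ∂H*(p₀) = {v : H*(p)−H*(p₀) ≥ v·(p−p₀) for all p}. Then for each ε>0 the set pr(G) is dense in the torus 𝕋ⁿ=ℝⁿ/ℤⁿ, where pr is the natural projection. -/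
open Set Filter Topology RealInnerProductSpace

noncomputable section

/-- The natural projection `pr : ℝⁿ → 𝕋ⁿ = ℝⁿ/ℤⁿ`. -/
def torusProj {n : ℕ} (x : EuclideanSpace ℝ (Fin n)) : Fin n → AddCircle (1 : ℝ) :=
  fun i => (x i : AddCircle (1 : ℝ))

theorem continuous_torusProj {n : ℕ} : Continuous (torusProj (n := n)) :=
  continuous_pi fun i => (AddCircle.continuous_mk' (1 : ℝ)).comp
    (EuclideanSpace.proj (𝕜 := ℝ) i).continuous

/-- A nontrivial character of the torus has zero mean. -/
theorem integral_mFourier_eq_zero_s11 {n : ℕ} {ξ : Fin n → ℤ} (hξ : ξ ≠ 0) :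
    ∫ x, UnitAddTorus.mFourier ξ x
      ∂(MeasureTheory.Measure.pi fun _ : Fin n => AddCircle.haarAddCircle (T := (1 : ℝ))) = 0 := by
  obtain ⟨i, hi⟩ := Function.ne_iff.mp hξ
  simp only [UnitAddTorus.mFourier, ContinuousMap.coe_mk]
  rw [MeasureTheory.integral_fintype_prod_eq_prod (𝕜 := ℂ)
    (μ := fun _ : Fin n => AddCircle.haarAddCircle (T := (1 : ℝ)))
    (fun i (x : AddCircle (1 : ℝ)) => fourier (ξ i) x)]
  refine Finset.prod_eq_zero (Finset.mem_univ i) ?_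
  exact MeasureTheory.integral_eq_zero_of_add_right_eq_neg
    (μ := AddCircle.haarAddCircle) (fourier_add_half_inv_index hi one_pos)

theorem mFourier_torusProj {n : ℕ} (ξ : Fin n → ℤ) (p : EuclideanSpace ℝ (Fin n)) (t : ℝ) :
    UnitAddTorus.mFourier ξ (torusProj (t • p)) =
      Complex.exp ((2 * Real.pi * (∑ i, (ξ i : ℝ) * p i : ℝ) * Complex.I) * t) := by
  simp only [UnitAddTorus.mFourier, torusProj, ContinuousMap.coe_mk, fourier_coe_apply]
  rw [← Complex.exp_sum]
  congr 1
  push_cast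
  simp only [Finset.mul_sum, Finset.sum_mul]
  refine Finset.sum_congr rfl fun i _ => ?_
  simp
  ring

/-- The mean of a character along the segment from `0` to `p` decays with the frequency. -/
theorem norm_integral_mFourier_segment_le {n : ℕ} (ξ : Fin n → ℤ) (p : EuclideanSpace ℝ (Fin n))
    (h : 0 < |∑ i, (ξ i : ℝ) * p i|) :
    ‖∫ t in (0 : ℝ)..1, UnitAddTorus.mFourier ξ (torusProj (t • p))‖ ≤
      2 / |∑ i, (ξ i : ℝ) * p i| := by
  simp only [mFourier_torusProj]
  set s : ℝ := ∑ i, (ξ i : ℝ) * p i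
  have hs : s ≠ 0 := abs_pos.mp h
  have hc : (2 * Real.pi * (s : ℂ) * Complex.I) ≠ 0 := by
    simp [hs, Real.pi_ne_zero]
  rw [integral_exp_mul_complex hc, norm_div]
  have hnum : ‖Complex.exp (2 * Real.pi * (s : ℂ) * Complex.I * (1 : ℝ)) -
      Complex.exp (2 * Real.pi * (s : ℂ) * Complex.I * (0 : ℝ))‖ ≤ 2 := by
    refine (norm_sub_le _ _).trans ?_
    have h1 : 2 * Real.pi * (s : ℂ) * Complex.I * (1 : ℝ) =
        ((2 * Real.pi * s : ℝ) : ℂ) * Complex.I := by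
      push_cast; ring
    rw [h1, Complex.norm_exp_ofReal_mul_I]
    norm_num
  have hden : |s| ≤ ‖2 * Real.pi * (s : ℂ) * Complex.I‖ := by
    simp only [norm_mul, Complex.norm_I, Complex.norm_real, Real.norm_eq_abs, mul_one,
      Complex.norm_ofNat, abs_of_pos Real.pi_pos]
    nlinarith [Real.pi_gt_three]
  gcongr

/-- If every nonzero frequency is unbounded along `u`, the segments from `0` to `u k` equidistribute
in the torus. -/
theorem tendsto_integral_segment {n : ℕ} {u : ℕ → EuclideanSpace ℝ (Fin n)}
    (hu : ∀ ξ : Fin n → ℤ, ξ ≠ 0 → Tendsto (fun k => |∑ i, (ξ i : ℝ) * u k i|) atTop atTop)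
    (g : C(UnitAddTorus (Fin n), ℂ)) :
    Tendsto (fun k => ∫ t in (0 : ℝ)..1, g (torusProj (t • u k))) atTop
      (𝓝 (∫ x, g x
        ∂(MeasureTheory.Measure.pi fun _ : Fin n => AddCircle.haarAddCircle (T := (1 : ℝ))))) := by
  set μ := MeasureTheory.Measure.pi fun _ : Fin n => AddCircle.haarAddCircle (T := (1 : ℝ))
  have hcont (g : C(UnitAddTorus (Fin n), ℂ)) (k : ℕ) :
      Continuous fun t : ℝ => g (torusProj (t • u k)) :=
    g.continuous.comp (continuous_torusProj.comp (by fun_prop))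
  have hii (g : C(UnitAddTorus (Fin n), ℂ)) (k : ℕ) :
      IntervalIntegrable (fun t : ℝ => g (torusProj (t • u k))) MeasureTheory.volume 0 1 :=
    (hcont g k).intervalIntegrable 0 1
  have hint (g : C(UnitAddTorus (Fin n), ℂ)) : MeasureTheory.Integrable g μ :=
    g.continuous.integrable_of_hasCompactSupport (HasCompactSupport.of_compactSpace _)
  have hspan : ∀ P ∈ Submodule.span ℂ (range (UnitAddTorus.mFourier (d := Fin n))),
      Tendsto (fun k => ∫ t in (0 : ℝ)..1, P (torusProj (t • u k))) atTop (𝓝 (∫ x, P x ∂μ)) := by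
    intro P hP
    induction hP using Submodule.span_induction with
    | mem P hP =>
      obtain ⟨ξ, rfl⟩ := hP
      by_cases hξ : ξ = 0
      · subst hξ
        simp [UnitAddTorus.mFourier_zero]
      · rw [integral_mFourier_eq_zero_s11 hξ]
        refine squeeze_zero_norm' ?_ ((hu ξ hξ).const_div_atTop 2)
        filter_upwards [(hu ξ hξ).eventually_gt_atTop 0] with k hk
        exact norm_integral_mFourier_segment_le ξ (u k) hk
    | zero => simp
    | add P Q _ _ hP hQ =>
      simp only [ContinuousMap.add_apply]
      rw [MeasureTheory.integral_add (hint P) (hint Q)]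
      refine (hP.add hQ).congr fun k => ?_
      rw [intervalIntegral.integral_add (hii P k) (hii Q k)]
    | smul c P _ hP =>
      simp only [ContinuousMap.smul_apply, MeasureTheory.integral_smul,
        intervalIntegral.integral_smul]
      exact hP.const_smul c
  have hmem : g ∈ closure (Submodule.span ℂ (range (UnitAddTorus.mFourier (d := Fin n))) :
      Set C(UnitAddTorus (Fin n), ℂ)) := by
    rw [← Submodule.topologicalClosure_coe, UnitAddTorus.span_mFourier_closure_eq_top]
    trivial
  rw [Metric.tendsto_atTop]
  intro η hη
  obtain ⟨P, hP, hgP⟩ := Metric.mem_closure_iff.mp hmem (η / 4) (by positivity)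
  obtain ⟨N, hN⟩ := Metric.tendsto_atTop.mp (hspan P hP) (η / 4) (by positivity)
  have hb (x) : ‖g x - P x‖ ≤ η / 4 := by
    rw [← dist_eq_norm]
    exact (ContinuousMap.dist_apply_le_dist x).trans hgP.le
  refine ⟨N, fun k hk => ?_⟩
  have h1 : dist (∫ t in (0 : ℝ)..1, g (torusProj (t • u k)))
      (∫ t in (0 : ℝ)..1, P (torusProj (t • u k))) ≤ η / 4 := by
    rw [dist_eq_norm, ← intervalIntegral.integral_sub (hii g k) (hii P k)]
    simpa using intervalIntegral.norm_integral_le_of_norm_le_const (a := (0 : ℝ)) (b := 1)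
      (f := fun t => g (torusProj (t • u k)) - P (torusProj (t • u k))) fun t _ => hb _
  have h2 : dist (∫ x, P x ∂μ) (∫ x, g x ∂μ) ≤ η / 4 := by
    rw [dist_comm, dist_eq_norm, ← MeasureTheory.integral_sub (hint g) (hint P)]
    simpa using MeasureTheory.norm_integral_le_of_norm_le_const (μ := μ)
      (f := fun x => g x - P x) (Eventually.of_forall hb)
  have := dist_triangle4 (∫ t in (0 : ℝ)..1, g (torusProj (t • u k)))
    (∫ t in (0 : ℝ)..1, P (torusProj (t • u k))) (∫ x, P x ∂μ) (∫ x, g x ∂μ)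
  linarith [hN k hk]

theorem dense_torusProj_image_of_tendsto {n : ℕ} {G : Set (EuclideanSpace ℝ (Fin n))}
    {u : ℕ → EuclideanSpace ℝ (Fin n)}
    (hu : ∀ ξ : Fin n → ℤ, ξ ≠ 0 → Tendsto (fun k => |∑ i, (ξ i : ℝ) * u k i|) atTop atTop)
    (hG : ∀ k, ∀ t ∈ Icc (0 : ℝ) 1, t • u k ∈ G) : Dense (torusProj '' G) := by
  by_contra hd
  obtain ⟨x₀, hx₀⟩ : ∃ x, x ∉ closure (torusProj '' G) := by
    simpa [Dense] using hd
  set S := closure (torusProj '' G)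
  have hS : S.Nonempty := ⟨_, subset_closure ⟨_, hG 0 0 (by simp), rfl⟩⟩
  let f : UnitAddTorus (Fin n) → ℝ := fun x => Metric.infDist x S
  have hf : Continuous f := Metric.continuous_infDist_pt S
  have hpos : 0 < ∫ x, f x
      ∂(MeasureTheory.Measure.pi fun _ : Fin n => AddCircle.haarAddCircle (T := (1 : ℝ))) :=
    hf.integral_pos_of_hasCompactSupport_nonneg_nonzero (x := x₀)
      (HasCompactSupport.of_compactSpace _) (fun _ => Metric.infDist_nonneg)
      ((isClosed_closure.notMem_iff_infDist_pos hS).mp hx₀).ne'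
  have hlim := tendsto_integral_segment hu ⟨fun x => (f x : ℂ), by fun_prop⟩
  have hzero (k : ℕ) : ∫ t in (0 : ℝ)..1, ((f (torusProj (t • u k)) : ℝ) : ℂ) = 0 := by
    rw [intervalIntegral.integral_congr (g := fun _ => 0), intervalIntegral.integral_zero]
    intro t ht
    rw [uIcc_of_le zero_le_one] at ht
    have : f (torusProj (t • u k)) = 0 :=
      Metric.infDist_zero_of_mem (subset_closure ⟨_, hG k t ht, rfl⟩)
    simp [this]
  simp only [ContinuousMap.coe_mk, hzero, integral_complex_ofReal] at hlim
  exact hpos.ne' (by exact_mod_cast (tendsto_nhds_unique hlim tendsto_const_nhds))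

/-- On a convex set, finitely many linear functionals that are each unbounded are simultaneously
large at some point. -/
theorem Convex.exists_forall_le_abs {E : Type*} [AddCommGroup E] [Module ℝ E] {G : Set E}
    (hG : Convex ℝ G) (hne : G.Nonempty) (F : Finset (E →ₗ[ℝ] ℝ))
    (hF : ∀ f ∈ F, ∀ M : ℝ, ∃ p ∈ G, M ≤ |f p|) (M : ℝ) : ∃ p ∈ G, ∀ f ∈ F, M ≤ |f p| := by
  classical
  induction F using Finset.induction_on generalizing M with
  | empty => exact ⟨hne.some, hne.some_mem, by simp⟩
  | insert f F hf ih =>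
    set k : ℕ := F.card + 1 with hk
    have hk0 : (0 : ℝ) < k := by positivity
    obtain ⟨p, hp, hpF⟩ := ih (fun g hg => hF g (Finset.mem_insert_of_mem hg))
      (|M| * (1 + 2 * k))
    obtain ⟨q, hq, hqf⟩ := hF f (Finset.mem_insert_self _ _) (|M| * (1 + 2 * k))
    let r : ℕ → E := fun l => AffineMap.lineMap p q ((l : ℝ) / k)
    have hr (l : ℕ) (g : E →ₗ[ℝ] ℝ) : g (r l) = g p + (l / k : ℝ) * (g q - g p) := by
      simp [r, AffineMap.lineMap_apply, add_comm]
    have hrG (l : ℕ) (hl : l ≤ k) : r l ∈ G := by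
      refine hG.lineMap_mem hp hq ⟨by positivity, ?_⟩
      rw [div_le_one hk0]
      exact_mod_cast hl
    have hbad (g : E →ₗ[ℝ] ℝ) (hg : g ∈ insert f F) (l m : ℕ) (hlk : l ≤ k) (hlm : l < m)
        (hl : |g (r l)| < M) (hm : |g (r m)| < M) : False := by
      rw [hr] at hl hm
      have hM : 0 < M := (abs_nonneg _).trans_lt hl
      rw [abs_of_pos hM] at hpF hqf
      set d := g q - g p with hd
      have hlm' : (1 : ℝ) ≤ (m : ℝ) - l := by
        have : (l : ℝ) + 1 ≤ m := by exact_mod_cast hlm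
        linarith
      have hdk : |d| ≤ 2 * k * M := by
        have h1 : |((m : ℝ) - l) / k * d| ≤ 2 * M := by
          have : ((m : ℝ) - l) / k * d = (g p + m / k * d) - (g p + l / k * d) := by ring
          rw [this]
          exact (abs_sub _ _).trans (by linarith)
        rw [abs_mul, abs_of_pos (by positivity), div_mul_eq_mul_div, div_le_iff₀ hk0] at h1
        nlinarith [abs_nonneg d]
      have hl1 : (l / k : ℝ) ≤ 1 := by
        rw [div_le_one hk0]; exact_mod_cast hlk
      have hl0 : (0 : ℝ) ≤ l / k := by positivity
      rcases Finset.mem_insert.mp hg with rfl | hgF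
      · have : |g q| ≤ |g p + l / k * d| + |(1 - l / k) * d| := by
          refine le_trans (le_of_eq ?_) (abs_add_le _ _)
          congr 1
          rw [hd]; ring
        rw [abs_mul, abs_of_nonneg (by linarith : (0 : ℝ) ≤ 1 - l / k)] at this
        nlinarith [abs_nonneg d]
      · have h2 := hpF g hgF
        have : |g p| ≤ |g p + l / k * d| + |l / k * d| := by
          refine le_trans (le_of_eq ?_) (abs_sub _ _)
          congr 1
          ring
        rw [abs_mul, abs_of_nonneg hl0] at this
        nlinarith [abs_nonneg d]
    by_contra! hcon
    choose! φ hφ hφM using fun l (hl : l ∈ Finset.range (k + 1)) =>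
      hcon (r l) (hrG l (Nat.lt_succ_iff.mp (Finset.mem_range.mp hl)))
    obtain ⟨l, hl, m, hm, hlm, heq⟩ := Finset.exists_ne_map_eq_of_card_lt_of_maps_to
      (s := Finset.range (k + 1)) (t := insert f F) (f := φ)
      (by rw [Finset.card_insert_of_notMem hf, Finset.card_range]; omega) hφ
    have hl' := hφM l hl
    have hm' := hφM m hm
    have hlk := Nat.lt_succ_iff.mp (Finset.mem_range.mp hl)
    have hmk := Nat.lt_succ_iff.mp (Finset.mem_range.mp hm)
    rcases hlm.lt_or_gt with h | h
    · exact hbad (φ l) (hφ l hl) l m hlk h hl' (heq ▸ hm')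
    · exact hbad (φ l) (hφ l hl) m l hmk h (heq ▸ hm') hl'

/-- The linear functional `p ↦ ξ · p` of an integer vector `ξ`. -/
def frequency {n : ℕ} (ξ : Fin n → ℤ) : EuclideanSpace ℝ (Fin n) →ₗ[ℝ] ℝ :=
  ∑ i, (ξ i : ℝ) • (EuclideanSpace.proj (𝕜 := ℝ) i).toLinearMap

theorem frequency_apply {n : ℕ} (ξ : Fin n → ℤ) (p : EuclideanSpace ℝ (Fin n)) :
    frequency ξ p = ∑ i, (ξ i : ℝ) * p i := by
  simp [frequency]

/-- A convex set containing `0` that is unbounded in every nonzero integer direction has dense image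
in the torus. -/
theorem Convex.dense_torusProj_image {n : ℕ} {G : Set (EuclideanSpace ℝ (Fin n))}
    (hG : Convex ℝ G) (h0 : 0 ∈ G)
    (hunb : ∀ ξ : Fin n → ℤ, ξ ≠ 0 → ∀ M : ℝ, ∃ p ∈ G, M ≤ |∑ i, (ξ i : ℝ) * p i|) :
    Dense (torusProj '' G) := by
  classical
  have hex (k : ℕ) : ∃ p ∈ G, ∀ ξ ∈ (Finset.Icc (fun _ : Fin n => -(k : ℤ)) fun _ => k).erase 0,
      (k : ℝ) ≤ |∑ i, (ξ i : ℝ) * p i| := by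
    obtain ⟨p, hp, hpF⟩ := hG.exists_forall_le_abs ⟨0, h0⟩
      (((Finset.Icc (fun _ : Fin n => -(k : ℤ)) fun _ => k).erase 0).image frequency)
      (by
        simp only [Finset.forall_mem_image, frequency_apply]
        exact fun ξ hξ => hunb ξ (Finset.ne_of_mem_erase hξ)) k
    simp only [Finset.forall_mem_image, frequency_apply] at hpF
    exact ⟨p, hp, fun ξ hξ => hpF hξ⟩
  choose u huG hu using hex
  refine dense_torusProj_image_of_tendsto (u := u) (fun ξ hξ => ?_) fun k t ht => ?_
  · refine tendsto_atTop_mono' _ ?_ tendsto_natCast_atTop_atTop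
    filter_upwards [eventually_ge_atTop (∑ i, (ξ i).natAbs)] with k hk
    refine hu k ξ (Finset.mem_erase.mpr ⟨hξ, Finset.mem_Icc.mpr ?_⟩)
    have hi (i : Fin n) : (ξ i).natAbs ≤ k :=
      (Finset.single_le_sum (f := fun i => (ξ i).natAbs) (fun _ _ => Nat.zero_le _)
        (Finset.mem_univ i)).trans hk
    exact ⟨fun i => by have := hi i; dsimp only; omega, fun i => by have := hi i; dsimp only; omega⟩
  · exact hG.smul_mem_of_zero_mem h0 (huG k) ht

section Legendre

variable {E : Type*} [NormedAddCommGroup E] [InnerProductSpace ℝ E] [FiniteDimensional ℝ E]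
  {H : E → ℝ}

/-- For convex superlinear `H`, the Legendre transform is finite. -/
theorem ConvexOn.bddAbove_range_inner_sub (hconv : ConvexOn ℝ univ H)
    (hcoerc : Tendsto (fun v : E => H v / ‖v‖) (cocompact _) atTop) (p : E) :
    BddAbove (range fun v => ⟪p, v⟫ - H v) := by
  have hcont : Continuous H := hconv.locallyLipschitz.continuous
  have hev := hcoerc.eventually_ge_atTop ‖p‖
  obtain ⟨K, hK, hKsub⟩ := mem_cocompact.mp hev
  obtain ⟨C, hC⟩ := hK.bddAbove_image (f := fun v => ⟪p, v⟫ - H v) (by fun_prop)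
  refine ⟨max C (max 0 (⟪p, (0 : E)⟫ - H 0)), ?_⟩
  rintro _ ⟨v, rfl⟩
  by_cases hv : v ∈ K
  · exact (hC ⟨v, hv, rfl⟩).trans (le_max_left _ _)
  · by_cases hv0 : v = 0
    · subst hv0
      exact (le_max_right _ _).trans (le_max_right _ _)
    · have h1 : ‖p‖ ≤ H v / ‖v‖ := hKsub hv
      rw [le_div_iff₀ (norm_pos_iff.mpr hv0)] at h1
      refine le_trans ?_ ((le_max_left _ _).trans (le_max_right _ _))
      dsimp only
      linarith [real_inner_le_norm p v]

/-- A subgradient `v` of the Legendre transform at a zero `p₀` satisfies `H v ≤ p₀ · v`. -/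
theorem ConvexOn.le_inner_of_mem_subdifferential_legendre (hconv : ConvexOn ℝ univ H)
    {p₀ v : E} (hv : ∀ q, ⟪v, q - p₀⟫ ≤ sSup (range fun w => ⟪q, w⟫ - H w)) : H v ≤ ⟪p₀, v⟫ := by
  refine le_of_forall_lt fun r hr => ?_
  obtain ⟨a, hra, haH⟩ := exists_between hr
  obtain ⟨l, c, hle, heq⟩ := ConvexOn.exists_affine_le_of_lt (𝕜 := ℝ) (mem_univ v) haH isClosed_univ
    (hconv.locallyLipschitz.continuous.lowerSemicontinuous.lowerSemicontinuousOn _) hconv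
  let q : E := (InnerProductSpace.toDual ℝ E).symm l
  have hq (w : E) : ⟪q, w⟫ = l w := InnerProductSpace.toDual_symm_apply
  have hsup : sSup (range fun w => ⟪q, w⟫ - H w) ≤ -c := by
    refine csSup_le (range_nonempty _) ?_
    rintro _ ⟨w, rfl⟩
    have : l w + c ≤ H w := by simpa using hle ⟨w, mem_univ w⟩
    simp only [hq]
    linarith
  have h1 := (hv q).trans hsup
  rw [inner_sub_right, real_inner_comm, hq, real_inner_comm] at h1
  have h2 : l v + c = a := by simpa using heq
  linarith

/-- Bipolar theorem for the set `{v | H v ≤ p₀ · v}`: it contains every `w` with `p · w ≤ ε` for all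
`p` that are at most `ε` on it. -/
theorem ConvexOn.le_inner_of_mem_bipolar (hconv : ConvexOn ℝ univ H) (hH0 : H 0 = 0) {p₀ w : E}
    {ε : ℝ} (hε : 0 < ε) (hw : ∀ p : E, (∀ v, H v ≤ ⟪p₀, v⟫ → ⟪p, v⟫ ≤ ε) → ⟪p, w⟫ ≤ ε) :
    H w ≤ ⟪p₀, w⟫ := by
  have hcont : Continuous H := hconv.locallyLipschitz.continuous
  by_contra hnot
  have hD : Convex ℝ {v | H v ≤ ⟪p₀, v⟫} := by
    intro x hx y hy a b ha hb hab
    have := hconv.2 (mem_univ x) (mem_univ y) ha hb hab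
    simp only [mem_ofPred_eq, smul_eq_mul, inner_add_right, inner_smul_right] at *
    nlinarith
  obtain ⟨l, c, hlD, hlw⟩ := geometric_hahn_banach_closed_point hD
    (isClosed_le hcont (by fun_prop)) hnot
  have hc : 0 < c := by simpa using hlD 0 (by simp [hH0])
  let q : E := (ε / c) • (InnerProductSpace.toDual ℝ E).symm l
  have hq (v : E) : ⟪q, v⟫ = ε / c * l v := by
    simp [q, inner_smul_left, InnerProductSpace.toDual_symm_apply]
  have hεc : ε / c * c = ε := div_mul_cancel₀ _ hc.ne'
  have hpos : 0 < ε / c := by positivity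
  have := hw q fun v hv => by
    rw [hq]
    nlinarith [hlD v hv]
  rw [hq] at this
  nlinarith

end Legendre

/-- **Corollary 2**: let `H` be convex, coercive, `H(0) = 0`, satisfying the non-degeneracy
condition (for each nonzero `ξ ∈ ℤⁿ`, `s ↦ H(sξ)` is not affine near `0`), `H*` its Legendre
transform, `p₀` with `H*(p₀) = 0`, and for `ε > 0` let
`G = {p : p·v ≤ ε for all v ∈ ∂H*(p₀)}`. Then `pr(G)` is dense in `𝕋ⁿ`. -/
theorem polar_set_dense_in_torus {n : ℕ} (H : EuclideanSpace ℝ (Fin n) → ℝ)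
    (hconv : ConvexOn ℝ Set.univ H) (hH0 : H 0 = 0)
    (hcoerc : Tendsto (fun v : EuclideanSpace ℝ (Fin n) => H v / ‖v‖)
      (Filter.cocompact _) Filter.atTop)
    (hND : ∀ ξ : EuclideanSpace ℝ (Fin n), (∀ i, ∃ k : ℤ, ξ i = (k : ℝ)) → ξ ≠ 0 →
      ∀ δ : ℝ, 0 < δ → ¬ ∃ α β : ℝ, ∀ s : ℝ, |s| < δ → H (s • ξ) = α * s + β)
    (Hstar : EuclideanSpace ℝ (Fin n) → ℝ)
    (hLeg : ∀ p, Hstar p = sSup (Set.range fun v => ⟪p, v⟫ - H v))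
    (p₀ : EuclideanSpace ℝ (Fin n)) (hp₀ : Hstar p₀ = 0)
    (ε : ℝ) (hε : 0 < ε)
    (G : Set (EuclideanSpace ℝ (Fin n)))
    (hG : G = {p | ∀ v : EuclideanSpace ℝ (Fin n),
      (∀ q, ⟪v, q - p₀⟫ ≤ Hstar q - Hstar p₀) → ⟪p, v⟫ ≤ ε}) :
    Dense (torusProj '' G) := by
  subst hG
  refine Convex.dense_torusProj_image ?_ ?_ fun ξ hξ M => ?_
  · intro x hx y hy a b ha hb hab v hv
    have h1 := hx v hv
    have h2 := hy v hv
    simp only [inner_add_left, real_inner_smul_left]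
    nlinarith
  · intro v _
    simpa using hε.le
  · by_contra! hbd
    have hM : 0 < M := by
      simpa using hbd 0 fun v _ => by simpa using hε.le
    let x : EuclideanSpace ℝ (Fin n) := WithLp.toLp 2 fun i => (ξ i : ℝ)
    have hx (p : EuclideanSpace ℝ (Fin n)) : ⟪p, x⟫ = ∑ i, (ξ i : ℝ) * p i := by
      simp [x, PiLp.inner_apply]
    have hx0 : x ≠ 0 := by
      intro h
      refine hξ (funext fun i => ?_)
      have := congrArg (fun y : EuclideanSpace ℝ (Fin n) => y i) h
      simpa [x] using this
    refine hND x (fun i => ⟨ξ i, rfl⟩) hx0 (ε / M) (by positivity) ⟨⟪p₀, x⟫, 0, fun s hs => ?_⟩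
    have hle : H (s • x) ≤ ⟪p₀, s • x⟫ := by
      refine hconv.le_inner_of_mem_bipolar hH0 hε fun p hp => ?_
      have hpM := hbd p fun v hv => hp v <|
        hconv.le_inner_of_mem_subdifferential_legendre fun q => by
          simpa only [hp₀, sub_zero, hLeg q] using hv q
      rw [← hx] at hpM
      rw [real_inner_smul_right]
      rw [lt_div_iff₀ hM] at hs
      calc s * ⟪p, x⟫ ≤ |s| * |⟪p, x⟫| := by rw [← abs_mul]; exact le_abs_self _
        _ ≤ |s| * M := by gcongr
        _ ≤ ε := hs.le
    have hge : ⟪p₀, s • x⟫ - H (s • x) ≤ 0 := by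
      rw [← hp₀, hLeg]
      exact le_csSup (hconv.bddAbove_range_inner_sub hcoerc p₀) ⟨s • x, rfl⟩
    rw [real_inner_smul_right] at hle hge
    linarith
end
end

section
/- A Bohr almost periodic function vanishing on a half-line vanishes identically: Let f:ℝ→ℝ be Bohr almost periodic (i.e. f is a uniform limit on ℝ of real trigonometric polynomials s ↦ ∑ a_k e^{2πiμ_k s} with μ_k ∈ ℝ). If f(s)=0 for all s ≥ 0, then f(s)=0 for all s ∈ ℝ. -/
open Set Filter Topology

noncomputable section

/-- A trigonometric polynomial `s ↦ ∑ a_k e^{2πi μ_k s}` on `ℝ`. -/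
def IsTrigPoly1 (P : ℝ → ℂ) : Prop :=
  ∃ (N : ℕ) (a : Fin N → ℂ) (μ : Fin N → ℝ), ∀ s : ℝ,
    P s = ∑ k, a k * Complex.exp (2 * Real.pi * Complex.I * Complex.ofReal (μ k * s))

/-- `f : ℝ → ℝ` is Bohr almost periodic: a uniform limit of (real parts of) trigonometric
polynomials. -/
def IsAP1 (f : ℝ → ℝ) : Prop :=
  ∀ ε : ℝ, 0 < ε → ∃ P : ℝ → ℂ, IsTrigPoly1 P ∧ ∀ s, |f s - (P s).re| ≤ ε

/-- A trigonometric polynomial returns arbitrarily close to any of its values at arbitrarily large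
integer translates. -/
theorem IsTrigPoly1.frequently_norm_sub_lt {P : ℝ → ℂ} (hP : IsTrigPoly1 P) (s : ℝ) {ε : ℝ}
    (hε : 0 < ε) : ∃ᶠ n : ℕ in atTop, ‖P (s + n) - P s‖ < ε := by
  obtain ⟨N, a, μ, hP⟩ := hP
  let g : Fin N → Circle := fun k => Circle.exp (2 * Real.pi * μ k)
  let h : (Fin N → Circle) → ℂ := fun x =>
    ∑ k, a k * Complex.exp (2 * Real.pi * Complex.I * Complex.ofReal (μ k * s)) * (x k : ℂ)
  have h_cont : Continuous h := by fun_prop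
  have h_one : h 1 = P s := by simp [h, hP]
  have h_pow (n : ℕ) : h (g ^ n) = P (s + n) := by
    rw [hP]
    refine Finset.sum_congr rfl fun k _ => ?_
    rw [mul_assoc, Pi.pow_apply, Circle.coe_pow, Circle.coe_exp, ← Complex.exp_nat_mul,
      ← Complex.exp_add]
    push_cast
    ring_nf
  have h_freq := (mapClusterPt_one_atTop_pow g).frequently
    (h_cont.continuousAt.preimage_mem_nhds (Metric.ball_mem_nhds (h 1) hε))
  simpa [h_one, h_pow, dist_eq_norm] using h_freq

/-- **A Bohr almost periodic function vanishing on a half-line vanishes identically.** -/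
theorem ap_vanishing_halfline (f : ℝ → ℝ) (hf : IsAP1 f) (h0 : ∀ s : ℝ, 0 ≤ s → f s = 0) :
    ∀ s : ℝ, f s = 0 := by
  intro s
  refine abs_eq_zero.mp (le_antisymm (le_of_forall_pos_le_add fun ε hε => ?_) (abs_nonneg _))
  obtain ⟨P, hP, hPf⟩ := hf (ε / 3) (by positivity)
  obtain ⟨n, hn, hns⟩ := ((hP.frequently_norm_sub_lt s (ε := ε / 3) (by positivity)).and_eventually
    (eventually_ge_atTop ⌈-s⌉₊)).exists
  have hsn : 0 ≤ s + n := by linarith [Nat.ceil_le.mp hns]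
  have h_re := (Complex.abs_re_le_norm (P (s + n) - P s)).trans hn.le
  have h_far := hPf (s + n)
  have h_near := hPf s
  rw [h0 _ hsn] at h_far
  rw [Complex.sub_re] at h_re
  rw [abs_le] at *
  constructor <;> linarith
end
end
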